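/- arXiv:2603.27795 — 5 statements merged into one kernel-verified Lean document; each statement's English description precedes it below -/
import Mathlib

section
/- Let Z = |MVC(G*)| and opt = E[Z]. Then for every t ≥ 0, Pr[|Z - opt| ≥ t] ≤ 2·exp(−t²/(4C·opt + 2t/3)), where C = 2(e/(e−1) + 2) < 8. -/
open Finset

noncomputable section
open scoped Classical

variable {V : Type*} [Fintype V] [DecidableEq V]

/-- The probability that the realized graph `G* ~ G_p` (each edge of the base edge set `E`
kept independently with probability `p`) has edge set exactly `F`. -/
def edgeWeight (p : ℝ) (E F : Finset (Sym2 V)) : ℝ :=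
  p ^ F.card * (1 - p) ^ (E \ F).card

/-- The probability of an event `A` of the realized graph `G* ~ G_p`, where `E` is the
edge set of the base graph. -/
def probEvent (p : ℝ) (E : Finset (Sym2 V)) (A : Finset (Sym2 V) → Prop) : ℝ :=
  ∑ F ∈ E.powerset, if A F then edgeWeight p E F else 0

/-- The expectation of a real-valued function of the realized graph `G* ~ G_p`. -/
def expVal (p : ℝ) (E : Finset (Sym2 V)) (X : Finset (Sym2 V) → ℝ) : ℝ :=
  ∑ F ∈ E.powerset, edgeWeight p E F * X F

/-- `C` is a vertex cover of the graph with edge set `F`. -/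
def IsCoverOf (C : Finset V) (F : Finset (Sym2 V)) : Prop :=
  ∀ e ∈ F, ∃ v ∈ C, v ∈ e

/-- `MVC` assigns to every spanning subgraph of the base graph (given by its edge set
`F ⊆ E`) a vertex cover of minimum size. -/
def IsMinCoverFn (E : Finset (Sym2 V)) (MVC : Finset (Sym2 V) → Finset V) : Prop :=
  ∀ F ⊆ E, IsCoverOf (MVC F) F ∧ ∀ C : Finset V, IsCoverOf C F → (MVC F).card ≤ C.card

/-- `opt = E[|MVC(G*)|]`. -/
def optVal (p : ℝ) (E : Finset (Sym2 V)) (MVC : Finset (Sym2 V) → Finset V) : ℝ :=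
  expVal p E fun F => ((MVC F).card : ℝ)

/-- The number of edges of the induced subgraph `G[V \ S]` of the base graph. -/
def inducedEdgeCount (G : SimpleGraph V) [DecidableRel G.Adj] (S : Finset V) : ℕ :=
  (G.edgeFinset.filter fun e => ∀ v ∈ e, v ∉ S).card

set_option linter.unusedSectionVars false

def avgOne (p : ℝ) (e : Sym2 V) (X : Finset (Sym2 V) → ℝ) (F : Finset (Sym2 V)) : ℝ :=
  p * X (insert e F) + (1 - p) * X (F.erase e)

def avgL (p : ℝ) : List (Sym2 V) → (Finset (Sym2 V) → ℝ) → (Finset (Sym2 V) → ℝ)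
  | [], X => X
  | e :: L, X => avgOne p e (avgL p L X)

def IndepOf (e : Sym2 V) (X : Finset (Sym2 V) → ℝ) : Prop :=
  ∀ F, X (insert e F) = X F ∧ X (F.erase e) = X F

lemma expVal_insert (p : ℝ) (E : Finset (Sym2 V)) (e : Sym2 V) (he : e ∉ E)
    (X : Finset (Sym2 V) → ℝ) :
    expVal p (insert e E) X =
      p * expVal p E (fun F => X (insert e F)) + (1 - p) * expVal p E X := by
  unfold expVal
  rw [Finset.sum_powerset_insert he, Finset.mul_sum, Finset.mul_sum, add_comm]
  congr 1
  · apply Finset.sum_congr rfl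
    intro F hF
    rw [Finset.mem_powerset] at hF
    have h1 : e ∉ F := fun h => he (hF h)
    have h2 : insert e E \ insert e F = E \ F := by
      ext x; simp only [Finset.mem_sdiff, Finset.mem_insert]
      constructor
      · rintro ⟨h | h, h'⟩
        · exact absurd (Or.inl h) h'
        · exact ⟨h, fun hh => h' (Or.inr hh)⟩
      · rintro ⟨h, h'⟩
        refine ⟨Or.inr h, ?_⟩
        rintro (rfl | hh)
        · exact he h
        · exact h' hh
    unfold edgeWeight
    rw [h2, Finset.card_insert_of_notMem h1, pow_succ]
    ring
  · apply Finset.sum_congr rfl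
    intro F hF
    rw [Finset.mem_powerset] at hF
    have h1 : e ∉ F := fun h => he (hF h)
    have h2 : insert e E \ F = insert e (E \ F) := by
      rw [Finset.insert_sdiff_of_notMem _ h1]
    unfold edgeWeight
    rw [h2, Finset.card_insert_of_notMem (by simp [he]), pow_succ]
    ring

lemma expVal_congr (p : ℝ) (E : Finset (Sym2 V)) {X Y : Finset (Sym2 V) → ℝ}
    (h : ∀ F ⊆ E, X F = Y F) : expVal p E X = expVal p E Y := by
  unfold expVal
  exact Finset.sum_congr rfl fun F hF => by rw [h F (Finset.mem_powerset.1 hF)]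

lemma expVal_add (p : ℝ) (E : Finset (Sym2 V)) (X Y : Finset (Sym2 V) → ℝ) :
    expVal p E (fun F => X F + Y F) = expVal p E X + expVal p E Y := by
  unfold expVal
  rw [← Finset.sum_add_distrib]
  exact Finset.sum_congr rfl fun F hF => by ring

lemma expVal_sub (p : ℝ) (E : Finset (Sym2 V)) (X Y : Finset (Sym2 V) → ℝ) :
    expVal p E (fun F => X F - Y F) = expVal p E X - expVal p E Y := by
  unfold expVal
  rw [← Finset.sum_sub_distrib]
  exact Finset.sum_congr rfl fun F hF => by ring

lemma expVal_smul (p : ℝ) (E : Finset (Sym2 V)) (a : ℝ) (X : Finset (Sym2 V) → ℝ) :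
    expVal p E (fun F => a * X F) = a * expVal p E X := by
  unfold expVal
  rw [Finset.mul_sum]
  exact Finset.sum_congr rfl fun F hF => by ring

lemma expVal_const (p : ℝ) (E : Finset (Sym2 V)) (a : ℝ) :
    expVal p E (fun _ => a) = a := by
  induction E using Finset.induction_on with
  | empty => simp [expVal, edgeWeight]
  | insert e E he ih => rw [expVal_insert p E e he, ih]; ring

lemma edgeWeight_nonneg {p : ℝ} (hp0 : 0 < p) (hp1 : p ≤ 1) (E F : Finset (Sym2 V)) :
    0 ≤ edgeWeight p E F := by
  unfold edgeWeight
  have : 0 ≤ 1 - p := by linarith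
  positivity

lemma expVal_mono {p : ℝ} (hp0 : 0 < p) (hp1 : p ≤ 1) (E : Finset (Sym2 V))
    {X Y : Finset (Sym2 V) → ℝ} (h : ∀ F ⊆ E, X F ≤ Y F) : expVal p E X ≤ expVal p E Y := by
  unfold expVal
  exact Finset.sum_le_sum fun F hF =>
    mul_le_mul_of_nonneg_left (h F (Finset.mem_powerset.1 hF)) (edgeWeight_nonneg hp0 hp1 E F)

lemma expVal_avgOne (p : ℝ) (E : Finset (Sym2 V)) (e : Sym2 V) (he : e ∈ E)
    (X : Finset (Sym2 V) → ℝ) : expVal p E (avgOne p e X) = expVal p E X := by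
  obtain ⟨E', hE', rfl⟩ : ∃ E', e ∉ E' ∧ insert e E' = E :=
    ⟨E.erase e, Finset.notMem_erase _ _, Finset.insert_erase he⟩
  rw [expVal_insert p E' e hE', expVal_insert p E' e hE']
  have h1 : expVal p E' (fun F => avgOne p e X (insert e F)) =
      expVal p E' (fun F => p * X (insert e F) + (1 - p) * X F) := by
    apply expVal_congr
    intro F hF
    have h1 : e ∉ F := fun h => hE' (hF h)
    simp [avgOne, Finset.erase_insert h1]
  have h2 : expVal p E' (avgOne p e X) =
      expVal p E' (fun F => p * X (insert e F) + (1 - p) * X F) := by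
    apply expVal_congr
    intro F hF
    have h1 : e ∉ F := fun h => hE' (hF h)
    simp [avgOne, Finset.erase_eq_of_notMem h1]
  rw [h1, h2, expVal_add, expVal_smul, expVal_smul]
  ring

lemma expVal_avgL (p : ℝ) (E : Finset (Sym2 V)) (L : List (Sym2 V)) (hL : ∀ e ∈ L, e ∈ E)
    (X : Finset (Sym2 V) → ℝ) : expVal p E (avgL p L X) = expVal p E X := by
  induction L with
  | nil => rfl
  | cons e L ih =>
    simp only [avgL]
    rw [expVal_avgOne p E e (hL e (by simp)), ih (fun e' h => hL e' (by simp [h]))]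

lemma avgL_mul (p : ℝ) (L : List (Sym2 V)) (c X : Finset (Sym2 V) → ℝ)
    (hc : ∀ e ∈ L, IndepOf e c) : avgL p L (fun F => c F * X F) = fun F => c F * avgL p L X F := by
  induction L with
  | nil => rfl
  | cons e L ih =>
    simp only [avgL]
    rw [ih (fun e' h => hc e' (by simp [h]))]
    funext F
    have := hc e (by simp) F
    simp only [avgOne, this.1, this.2]
    ring

lemma avgOne_pos {p : ℝ} (hp0 : 0 < p) (hp1 : p ≤ 1) (e : Sym2 V) (X : Finset (Sym2 V) → ℝ)
    (hX : ∀ F, 0 < X F) (F) : 0 < avgOne p e X F := by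
  unfold avgOne
  have h1 := mul_pos hp0 (hX (insert e F))
  have h2 := mul_nonneg (sub_nonneg.2 hp1) (hX (F.erase e)).le
  linarith

lemma avgL_pos {p : ℝ} (hp0 : 0 < p) (hp1 : p ≤ 1) (L : List (Sym2 V))
    (X : Finset (Sym2 V) → ℝ)
    (hX : ∀ F, 0 < X F) (F) : 0 < avgL p L X F := by
  induction L generalizing F with
  | nil => exact hX F
  | cons e L ih => exact avgOne_pos hp0 hp1 e _ ih F

lemma indep_avgOne_self (p : ℝ) (e : Sym2 V) (X : Finset (Sym2 V) → ℝ) :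
    IndepOf e (avgOne p e X) := by
  intro F
  have h : insert e (F.erase e) = insert e F := by
    ext x; by_cases hx : x = e <;> simp [hx]
  simp [avgOne, h]

lemma indep_avgOne (p : ℝ) (e e' : Sym2 V) (X : Finset (Sym2 V) → ℝ) (h : IndepOf e X) :
    IndepOf e (avgOne p e' X) := by
  by_cases hee : e = e'
  · subst hee; exact indep_avgOne_self p e X
  intro F
  unfold avgOne
  rw [Finset.insert_comm e' e, Finset.erase_insert_of_ne hee, (h _).1, (h _).1,
    Finset.erase_right_comm, (h _).2]
  refine ⟨rfl, ?_⟩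
  rw [← Finset.erase_insert_of_ne (Ne.symm hee), (h _).2]

lemma indep_avgL (p : ℝ) (e : Sym2 V) (L : List (Sym2 V)) (X : Finset (Sym2 V) → ℝ)
    (h : IndepOf e X ∨ e ∈ L) : IndepOf e (avgL p L X) := by
  induction L with
  | nil => simpa [avgL] using h
  | cons e' L ih =>
    simp only [avgL]
    by_cases hee : e = e'
    · subst hee; exact indep_avgOne_self p e _
    · apply indep_avgOne
      apply ih
      simpa [hee] using h

lemma ent_step {p : ℝ} (hp0 : 0 < p) (hp1 : p ≤ 1) (E : Finset (Sym2 V)) (L : List (Sym2 V))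
    (hL : ∀ e ∈ L, e ∈ E) (Y W c : Finset (Sym2 V) → ℝ) (hY : ∀ F, 0 < Y F) (hW : ∀ F, 0 < W F)
    (hc : ∀ F, 0 < c F) (hci : ∀ e ∈ L, IndepOf e c) :
    expVal p E (fun F => Y F * Real.log (W F)) - expVal p E (fun F => Y F * Real.log (avgL p L W F))
      ≤ expVal p E (fun F => Y F * Real.log (Y F) - Y F * Real.log (c F) - Y F + c F) := by
  have hD : ∀ F, 0 < avgL p L W F := avgL_pos hp0 hp1 L W hW
  have hDi : ∀ e ∈ L, IndepOf e (avgL p L W) := fun e he => indep_avgL p e L W (Or.inr he)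
  have key : expVal p E (fun F => (c F * (avgL p L W F)⁻¹) * W F) = expVal p E c := by
    rw [← expVal_avgL p E L hL]
    rw [avgL_mul p L (fun F => c F * (avgL p L W F)⁻¹) W]
    · apply expVal_congr
      intro F _
      have := (hD F).ne'
      field_simp
    · intro e he F
      simp only [(hci e he F).1, (hci e he F).2, (hDi e he F).1, (hDi e he F).2, and_self]
  rw [← expVal_sub, expVal_add, ← key, ← expVal_add]
  apply expVal_mono hp0 hp1
  intro F _
  have h1 : Real.log (c F * (avgL p L W F)⁻¹ * W F / Y F) ≤ c F * (avgL p L W F)⁻¹ * W F / Y F - 1 := by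
    apply Real.log_le_sub_one_of_pos
    have := hD F; have := hc F; have := hY F; have := hW F
    positivity
  have h2 := mul_le_mul_of_nonneg_left h1 (hY F).le
  rw [Real.log_div (by have := hD F; have := hc F; have := hW F; positivity) (hY F).ne',
    Real.log_mul (by have := hD F; have := hc F; positivity) (hW F).ne',
    Real.log_mul (hc F).ne' (inv_ne_zero (hD F).ne'), Real.log_inv] at h2
  have h3 : Y F * (c F * (avgL p L W F)⁻¹ * W F / Y F - 1) =
    c F * (avgL p L W F)⁻¹ * W F - Y F := by
    have := (hY F).ne'
    field_simp
  rw [h3] at h2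
  linarith

def avgAll {ι : Type*} (p : ℝ) (B : ι → Finset (Sym2 V)) :
    List ι → (Finset (Sym2 V) → ℝ) → (Finset (Sym2 V) → ℝ)
  | [], X => X
  | i :: l, X => avgL p (B i).toList (avgAll p B l X)

lemma avgAll_pos {ι : Type*} {p : ℝ} (hp0 : 0 < p) (hp1 : p ≤ 1) (B : ι → Finset (Sym2 V))
    (l : List ι) (X : Finset (Sym2 V) → ℝ)
    (hX : ∀ F, 0 < X F) (F) : 0 < avgAll p B l X F := by
  induction l generalizing F with
  | nil => exact hX F
  | cons e L ih => exact avgL_pos hp0 hp1 _ _ ih F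

lemma expVal_avgAll {ι : Type*} (p : ℝ) (E : Finset (Sym2 V)) (B : ι → Finset (Sym2 V))
    (hB : ∀ i, B i ⊆ E) (l : List ι)
    (X : Finset (Sym2 V) → ℝ) : expVal p E (avgAll p B l X) = expVal p E X := by
  induction l with
  | nil => rfl
  | cons e L ih =>
    simp only [avgAll]
    rw [expVal_avgL p E _ (fun x hx => hB _ (Finset.mem_toList.1 hx)), ih]

lemma indep_avgAll {ι : Type*} (p : ℝ) (B : ι → Finset (Sym2 V)) (e : Sym2 V)
    (l : List ι) (X : Finset (Sym2 V) → ℝ)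
    (h : ∃ i ∈ l, e ∈ B i) : IndepOf e (avgAll p B l X) := by
  induction l with
  | nil => simp at h
  | cons i L ih =>
    simp only [avgAll]
    apply indep_avgL
    obtain ⟨j, hj, hej⟩ := h
    rcases List.mem_cons.1 hj with rfl | hj
    · right; simpa using hej
    · left; exact ih ⟨j, hj, hej⟩

lemma avgAll_const {ι : Type*} (p : ℝ) (E : Finset (Sym2 V)) (B : ι → Finset (Sym2 V))
    (hB : ∀ i, B i ⊆ E) (l : List ι) (hl : ∀ e ∈ E, ∃ i ∈ l, e ∈ B i)
    (X : Finset (Sym2 V) → ℝ) : ∀ F ⊆ E, avgAll p B l X F = expVal p E X := by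
  have h1 : ∀ F ⊆ E, avgAll p B l X F = avgAll p B l X ∅ := by
    intro F
    induction F using Finset.induction_on with
    | empty => intro _; rfl
    | insert e F he ih =>
      intro hF
      rw [(indep_avgAll p B e l X (hl e (hF (Finset.mem_insert_self _ _))) F).1]
      exact ih fun x hx => hF (Finset.mem_insert_of_mem hx)
  intro F hF
  rw [h1 F hF, ← expVal_avgAll p E B hB l X, expVal_congr p E h1, expVal_const]

lemma ent_tel {ι : Type*} {p : ℝ} (hp0 : 0 < p) (hp1 : p ≤ 1) (E : Finset (Sym2 V))
    (B : ι → Finset (Sym2 V)) (hB : ∀ i, B i ⊆ E) (Y : Finset (Sym2 V) → ℝ)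
    (c : ι → Finset (Sym2 V) → ℝ) (hY : ∀ F, 0 < Y F)
    (hc : ∀ i F, 0 < c i F) (hci : ∀ i, ∀ e ∈ B i, IndepOf e (c i)) (l : List ι) :
    expVal p E (fun F => Y F * Real.log (Y F)) -
        expVal p E (fun F => Y F * Real.log (avgAll p B l Y F))
      ≤ (l.map fun i => expVal p E
        (fun F => Y F * Real.log (Y F) - Y F * Real.log (c i F) - Y F + c i F)).sum := by
  induction l with
  | nil => simp [avgAll]
  | cons i l ih =>
    have := ent_step hp0 hp1 E (B i).toList (fun x hx => hB _ (Finset.mem_toList.1 hx)) Y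
      (avgAll p B l Y) (c i) hY (avgAll_pos hp0 hp1 B l Y hY) (hc i)
      (fun e he => hci i e (Finset.mem_toList.1 he))
    simp only [List.map_cons, List.sum_cons, avgAll]
    linarith

lemma entropy_ineq {ι : Type*} [Fintype ι] {p : ℝ} (hp0 : 0 < p) (hp1 : p ≤ 1)
    (E : Finset (Sym2 V))
    (B : ι → Finset (Sym2 V)) (hB : ∀ i, B i ⊆ E) (hcov : ∀ e ∈ E, ∃ i, e ∈ B i)
    (Y : Finset (Sym2 V) → ℝ)
    (c : ι → Finset (Sym2 V) → ℝ) (hY : ∀ F, 0 < Y F)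
    (hc : ∀ i F, 0 < c i F) (hci : ∀ i, ∀ e ∈ B i, IndepOf e (c i)) :
    expVal p E (fun F => Y F * Real.log (Y F)) - expVal p E Y * Real.log (expVal p E Y)
      ≤ expVal p E (fun F => ∑ i, (Y F * Real.log (Y F) - Y F * Real.log (c i F) - Y F + c i F)) := by
  have h := ent_tel hp0 hp1 E B hB Y c hY hc hci (Finset.univ : Finset ι).toList
  have h2 : expVal p E (fun F => Y F * Real.log (avgAll p B (Finset.univ : Finset ι).toList Y F)) =
      expVal p E Y * Real.log (expVal p E Y) := by
    rw [mul_comm (expVal p E Y), ← expVal_smul]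
    apply expVal_congr
    intro F hF
    rw [avgAll_const p E B hB _ _ Y F hF, mul_comm]
    intro e he
    obtain ⟨i, hi⟩ := hcov e he
    exact ⟨i, by simp, hi⟩
  rw [h2] at h
  refine h.trans (le_of_eq ?_)
  rw [Finset.sum_map_toList]
  unfold expVal
  rw [Finset.sum_comm]
  apply Finset.sum_congr rfl
  intro F _
  rw [Finset.mul_sum]

def mgf0 (p : ℝ) (E : Finset (Sym2 V)) (f : Finset (Sym2 V) → ℕ) (x : ℝ) : ℝ :=
  expVal p E (fun F => Real.exp (x * f F))

def mgf1 (p : ℝ) (E : Finset (Sym2 V)) (f : Finset (Sym2 V) → ℕ) (x : ℝ) : ℝ :=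
  expVal p E (fun F => (f F : ℝ) * Real.exp (x * f F))

lemma mgf0_pos {p : ℝ} (hp0 : 0 < p) (hp1 : p ≤ 1) (E : Finset (Sym2 V))
    (f : Finset (Sym2 V) → ℕ) (x : ℝ) : 0 < mgf0 p E f x := by
  obtain ⟨F0, _, hmin⟩ := Finset.exists_min_image E.powerset (fun F => Real.exp (x * f F))
    ⟨∅, Finset.mem_powerset.2 (Finset.empty_subset E)⟩
  refine (Real.exp_pos (x * f F0)).trans_le ?_
  rw [← expVal_const p E (Real.exp (x * f F0))]
  apply expVal_mono hp0 hp1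
  intro F hF
  exact hmin F (Finset.mem_powerset.2 hF)

lemma mgf1_nonneg {p : ℝ} (hp0 : 0 < p) (hp1 : p ≤ 1) (E : Finset (Sym2 V))
    (f : Finset (Sym2 V) → ℕ) (x : ℝ) : 0 ≤ mgf1 p E f x := by
  rw [← expVal_const p E 0]
  apply expVal_mono hp0 hp1
  intro F hF
  positivity

lemma mgf0_deriv (p : ℝ) (E : Finset (Sym2 V))
    (f : Finset (Sym2 V) → ℕ) (x : ℝ) : HasDerivAt (mgf0 p E f) (mgf1 p E f x) x := by
  unfold mgf0 mgf1 expVal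
  apply HasDerivAt.fun_sum
  intro F _
  apply HasDerivAt.const_mul
  have h := ((hasDerivAt_id x).mul_const (f F : ℝ)).exp
  simp only [id, one_mul] at h
  exact h.congr_deriv (mul_comm _ _)

lemma log_mgf_deriv {p : ℝ} (hp0 : 0 < p) (hp1 : p ≤ 1) (E : Finset (Sym2 V))
    (f : Finset (Sym2 V) → ℕ) (x : ℝ) :
    HasDerivAt (fun y => Real.log (mgf0 p E f y)) (mgf1 p E f x / mgf0 p E f x) x :=
  (mgf0_deriv p E f x).log (mgf0_pos hp0 hp1 E f x).ne'

def SelfBdd {ι : Type*} [Fintype ι] (E : Finset (Sym2 V)) (B : ι → Finset (Sym2 V))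
    (f : Finset (Sym2 V) → ℕ) (a : ℝ) : Prop :=
  (∀ i, B i ⊆ E) ∧ (∀ e ∈ E, ∃ i, e ∈ B i) ∧
  ∀ F ⊆ E, (∀ i, f (F \ B i) ≤ f F ∧ f F ≤ f (F \ B i) + 1) ∧
    ∑ i, ((f F : ℝ) - f (F \ B i)) ≤ a * f F

lemma selfBdd_ineq {ι : Type*} [Fintype ι] {p : ℝ} (hp0 : 0 < p) (hp1 : p ≤ 1)
    (E : Finset (Sym2 V)) (B : ι → Finset (Sym2 V))
    (f : Finset (Sym2 V) → ℕ) (a : ℝ) (hf : SelfBdd E B f a) (x : ℝ) :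
    (x - a * (Real.exp (-x) + x - 1)) * (mgf1 p E f x / mgf0 p E f x) ≤
      Real.log (mgf0 p E f x) := by
  obtain ⟨hB, hcov, hF⟩ := hf
  have h := entropy_ineq hp0 hp1 E B hB hcov (fun F => Real.exp (x * f F))
    (fun i F => Real.exp (x * f (F \ B i))) (fun F => Real.exp_pos _) (fun i F => Real.exp_pos _)
    (by
      intro i e he F
      have h1 : insert e F \ B i = F \ B i := Finset.insert_sdiff_of_mem _ he
      have h2 : F.erase e \ B i = F \ B i := by
        ext y
        simp only [Finset.mem_sdiff, Finset.mem_erase]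
        constructor
        · rintro ⟨⟨_, h⟩, h'⟩; exact ⟨h, h'⟩
        · rintro ⟨h, h'⟩
          refine ⟨⟨?_, h⟩, h'⟩
          rintro rfl
          exact h' he
      simp only [h1, h2, and_self])
  simp only [Real.log_exp] at h
  have e1 : expVal p E (fun F => Real.exp (x * f F) * (x * f F)) = x * mgf1 p E f x := by
    unfold mgf1
    rw [← expVal_smul]
    apply expVal_congr
    intro F _
    ring
  have hphi : 0 ≤ Real.exp (-x) + x - 1 := by
    have := Real.add_one_le_exp (-x); linarith
  have e2 : expVal p E (fun F => ∑ i, (Real.exp (x * f F) * (x * f F) -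
      Real.exp (x * f F) * (x * f (F \ B i)) - Real.exp (x * f F) + Real.exp (x * f (F \ B i)))) ≤
      a * (Real.exp (-x) + x - 1) * mgf1 p E f x := by
    unfold mgf1
    rw [← expVal_smul]
    apply expVal_mono hp0 hp1
    intro F hFE
    obtain ⟨h1, h2⟩ := hF F hFE
    have h3 : ∀ i, (Real.exp (x * f F) * (x * f F) -
      Real.exp (x * f F) * (x * f (F \ B i)) - Real.exp (x * f F) + Real.exp (x * f (F \ B i))) =
      (Real.exp (x * f F) * (Real.exp (-x) + x - 1)) * ((f F : ℝ) - f (F \ B i)) := by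
      intro i
      obtain ⟨h4, h5⟩ := h1 i
      have h6 : f F = f (F \ B i) ∨ f F = f (F \ B i) + 1 := by omega
      rcases h6 with h6 | h6
      · rw [← h6]; ring
      · have h7 : (f (F \ B i) : ℝ) = f F - 1 := by rw [h6]; push_cast; ring
        rw [h7]
        have : x * ((f F : ℝ) - 1) = x * f F + -x := by ring
        rw [this, Real.exp_add]; ring
    rw [Finset.sum_congr rfl (fun i _ => h3 i), ← Finset.mul_sum]
    have := mul_le_mul_of_nonneg_left h2 (mul_nonneg (Real.exp_pos (x * f F)).le hphi)
    refine this.trans (le_of_eq (by ring))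
  rw [e1] at h
  have hM := mgf0_pos hp0 hp1 E f x
  have h' : x * mgf1 p E f x - mgf0 p E f x * Real.log (mgf0 p E f x) ≤
     a * (Real.exp (-x) + x - 1) * mgf1 p E f x := h.trans e2
  rw [← mul_div_assoc, div_le_iff₀ hM]
  linarith

lemma ode_lemma (g g' q q' : ℝ → ℝ) (m b : ℝ) (hb : 0 < b)
    (hg : ∀ x ∈ Set.Icc 0 b, HasDerivAt g (g' x) x)
    (hq : ∀ x ∈ Set.Icc 0 b, HasDerivAt q (q' x) x)
    (hg0 : g 0 = 0) (hq0 : q 0 = 0) (hgm : g' 0 = m) (hqm : q' 0 = 1)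
    (hpos : ∀ x ∈ Set.Ioc 0 b, 0 < q x)
    (hineq : ∀ x ∈ Set.Ioo 0 b, g' x * q x ≤ q' x * g x) : g b ≤ m * q b := by
  have hanti : AntitoneOn (fun x => g x / q x) (Set.Ioc 0 b) := by
    apply antitoneOn_of_hasDerivWithinAt_nonpos (convex_Ioc 0 b)
      (f' := fun x => (g' x * q x - g x * q' x) / (q x) ^ 2)
    · intro x hx
      have hx' : x ∈ Set.Icc 0 b := ⟨hx.1.le, hx.2⟩
      exact (((hg x hx').div (hq x hx') (hpos x hx).ne').continuousAt).continuousWithinAt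
    · intro x hx
      rw [interior_Ioc] at hx
      have hx' : x ∈ Set.Icc 0 b := ⟨hx.1.le, hx.2.le⟩
      exact ((hg x hx').div (hq x hx') (hpos x ⟨hx.1, hx.2.le⟩).ne').hasDerivWithinAt
    · intro x hx
      rw [interior_Ioc] at hx
      have := hineq x hx
      apply div_nonpos_of_nonpos_of_nonneg
      · linarith
      · positivity
  have h0 : (0:ℝ) ∈ Set.Icc 0 b := ⟨le_refl _, hb.le⟩
  have t1 := (hasDerivAt_iff_tendsto_slope_zero.1 (hg 0 h0))
  have t2 := (hasDerivAt_iff_tendsto_slope_zero.1 (hq 0 h0))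
  simp only [zero_add, hg0, hq0, sub_zero, smul_eq_mul, hgm, hqm] at t1 t2
  have t3 := t1.div t2 one_ne_zero
  have t4 : Filter.Tendsto (fun x => g x / q x) (nhdsWithin 0 (Set.Ioi 0)) (nhds (m / 1)) := by
    refine (t3.mono_left (nhdsWithin_mono 0 ?_)).congr' ?_
    · intro x hx; exact (ne_of_gt hx)
    · filter_upwards [self_mem_nhdsWithin] with x hx
      have hx' : x ≠ 0 := ne_of_gt hx
      simp only [Pi.div_apply]
      rw [mul_div_mul_left _ _ (inv_ne_zero hx')]
  have hlast : g b / q b ≤ m / 1 := by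
    apply ge_of_tendsto t4
    have : Set.Ioc 0 b ∈ nhdsWithin (0:ℝ) (Set.Ioi 0) := Ioc_mem_nhdsGT hb
    filter_upwards [this] with x hx
    exact hanti hx ⟨hb, le_refl _⟩ hx.2
  rw [div_one, div_le_iff₀ (hpos b ⟨hb, le_refl _⟩)] at hlast
  exact hlast

section conc
variable {ι : Type*} [Fintype ι]

lemma mgf0_zero (p : ℝ) (E : Finset (Sym2 V)) (f : Finset (Sym2 V) → ℕ) : mgf0 p E f 0 = 1 := by
  simp [mgf0, expVal_const]

lemma mgf1_zero (p : ℝ) (E : Finset (Sym2 V)) (f : Finset (Sym2 V) → ℕ) :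
    mgf1 p E f 0 = expVal p E (fun F => (f F : ℝ)) := by
  simp [mgf1]

lemma upper_one {p : ℝ} (hp0 : 0 < p) (hp1 : p ≤ 1)
    (E : Finset (Sym2 V)) (B : ι → Finset (Sym2 V))
    (f : Finset (Sym2 V) → ℕ) (hf : SelfBdd E B f 1) (x : ℝ) (hx : 0 < x) :
    Real.log (mgf0 p E f x) ≤ expVal p E (fun F => (f F : ℝ)) * (Real.exp x - 1) := by
  apply ode_lemma (fun y => Real.log (mgf0 p E f y)) (fun y => mgf1 p E f y / mgf0 p E f y)
    (fun y => Real.exp y - 1) (fun y => Real.exp y) _ _ hx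
  · intro y _; exact log_mgf_deriv hp0 hp1 E f y
  · intro y _; exact (Real.hasDerivAt_exp y).sub_const 1
  · simp [mgf0_zero]
  · simp
  · simp [mgf0_zero, mgf1_zero]
  · simp
  · intro y hy
    have := Real.add_one_lt_exp hy.1.ne'
    have := hy.1
    linarith
  · intro y hy
    have h := selfBdd_ineq hp0 hp1 E B f 1 hf y
    have h2 := mul_le_mul_of_nonneg_left h (Real.exp_pos y).le
    have h3 : Real.exp y * Real.exp (-y) = 1 := by rw [← Real.exp_add]; simp
    calc mgf1 p E f y / mgf0 p E f y * (Real.exp y - 1)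
        = Real.exp y * ((y - 1 * (Real.exp (-y) + y - 1)) * (mgf1 p E f y / mgf0 p E f y)) := by
          linear_combination (mgf1 p E f y / mgf0 p E f y) * h3
      _ ≤ _ := h2

lemma upper_two {p : ℝ} (hp0 : 0 < p) (hp1 : p ≤ 1)
    (E : Finset (Sym2 V)) (B : ι → Finset (Sym2 V))
    (f : Finset (Sym2 V) → ℕ) (hf : SelfBdd E B f 2) (x : ℝ) (hx : 0 < x) (hx1 : x < 1) :
    Real.log (mgf0 p E f x) ≤ expVal p E (fun F => (f F : ℝ)) * (x / (1 - x)) := by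
  apply ode_lemma (fun y => Real.log (mgf0 p E f y)) (fun y => mgf1 p E f y / mgf0 p E f y)
    (fun y => y / (1 - y)) (fun y => 1 / (1 - y) ^ 2) _ _ hx
  · intro y _; exact log_mgf_deriv hp0 hp1 E f y
  · intro y hy
    have h1 : (1 - y) ≠ 0 := by have := hy.2; intro h; linarith
    have := (hasDerivAt_id' y).fun_div ((hasDerivAt_id' y).const_sub 1) h1
    exact this.congr_deriv (by ring)
  · simp [mgf0_zero]
  · simp
  · simp [mgf0_zero, mgf1_zero]
  · simp
  · intro y hy
    have h2 := hy.2
    exact div_pos hy.1 (by linarith)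
  · intro y hy
    have hy1 : 0 < 1 - y := by have := hy.2; linarith
    have hy0 := hy.1
    have h := selfBdd_ineq hp0 hp1 E B f 2 hf y
    have hr : 0 ≤ mgf1 p E f y / mgf0 p E f y :=
      div_nonneg (mgf1_nonneg hp0 hp1 E f y) (mgf0_pos hp0 hp1 E f y).le
    have hexp : Real.exp (-y) ≤ 1 - y + y ^ 2 / 2 := by
      have h1 : 1 + y + y ^ 2 / 2 ≤ Real.exp y := Real.quadratic_le_exp_of_nonneg hy0.le
      have h2 : Real.exp y * Real.exp (-y) = 1 := by rw [← Real.exp_add]; simp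
      have h3 : 0 < 1 - y + y ^ 2 / 2 := by nlinarith
      have h4 : 1 ≤ (1 - y + y ^ 2 / 2) * Real.exp y := by
        have := mul_le_mul_of_nonneg_left h1 h3.le
        nlinarith [sq_nonneg (y ^ 2)]
      have h5 := mul_le_mul_of_nonneg_right h4 (Real.exp_pos (-y)).le
      rw [mul_assoc, h2] at h5
      linarith
    have h2 : (y * (1 - y)) * (mgf1 p E f y / mgf0 p E f y) ≤ Real.log (mgf0 p E f y) := by
      refine le_trans ?_ h
      apply mul_le_mul_of_nonneg_right _ hr
      nlinarith
    have h3 := mul_le_mul_of_nonneg_left h2 (by positivity : 0 ≤ 1 / (1 - y) ^ 2)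
    refine le_trans (le_of_eq ?_) h3
    field_simp

lemma lower_two {p : ℝ} (hp0 : 0 < p) (hp1 : p ≤ 1)
    (E : Finset (Sym2 V)) (B : ι → Finset (Sym2 V))
    (f : Finset (Sym2 V) → ℕ) (hf : SelfBdd E B f 2) (x : ℝ) (hx : 0 < x) (hx1 : x < 1) :
    Real.log (mgf0 p E f (-x)) ≤ -expVal p E (fun F => (f F : ℝ)) * (x / (1 + 2 * x)) := by
  apply ode_lemma (fun y => Real.log (mgf0 p E f (-y)))
    (fun y => -(mgf1 p E f (-y) / mgf0 p E f (-y)))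
    (fun y => y / (1 + 2 * y)) (fun y => 1 / (1 + 2 * y) ^ 2) _ _ hx
  · intro y _
    have := (log_mgf_deriv hp0 hp1 E f (-y)).comp y (hasDerivAt_neg y)
    exact this.congr_deriv (by ring)
  · intro y hy
    have h1 : (1 + 2 * y) ≠ 0 := by have := hy.1; intro h; linarith
    have := (hasDerivAt_id' y).fun_div (((hasDerivAt_id' y).const_mul 2).const_add 1) h1
    exact this.congr_deriv (by ring)
  · simp [mgf0_zero]
  · simp
  · simp [mgf0_zero, mgf1_zero]
  · simp
  · intro y hy
    have h2 := hy.1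
    exact div_pos hy.1 (by linarith)
  · intro y hy
    have hy0 := hy.1
    have hy1 : 0 < 1 + 2 * y := by linarith
    have h := selfBdd_ineq hp0 hp1 E B f 2 hf (-y)
    have hr : 0 ≤ mgf1 p E f (-y) / mgf0 p E f (-y) :=
      div_nonneg (mgf1_nonneg hp0 hp1 E f _) (mgf0_pos hp0 hp1 E f _).le
    have hexp : Real.exp y ≤ 1 + y + y ^ 2 := by
      have := Real.abs_exp_sub_one_sub_id_le (x := y) (by rw [abs_of_pos hy0]; linarith [hy.2])
      have := (abs_le.1 this).2
      linarith
    rw [neg_neg] at h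
    have h2 : -(y * (1 + 2 * y)) * (mgf1 p E f (-y) / mgf0 p E f (-y)) ≤
        Real.log (mgf0 p E f (-y)) := by
      refine le_trans ?_ h
      apply mul_le_mul_of_nonneg_right _ hr
      nlinarith
    have h3 := mul_le_mul_of_nonneg_left h2 (by positivity : 0 ≤ 1 / (1 + 2 * y) ^ 2)
    refine le_trans (le_of_eq ?_) h3
    field_simp

end conc

lemma markov_exp {p : ℝ} (hp0 : 0 < p) (hp1 : p ≤ 1) (E : Finset (Sym2 V))
    (f : Finset (Sym2 V) → ℕ) (A : Finset (Sym2 V) → Prop) (x s : ℝ)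
    (hA : ∀ F ⊆ E, A F → s ≤ x * f F) :
    probEvent p E A ≤ Real.exp (Real.log (mgf0 p E f x) - s) := by
  rw [Real.exp_sub, Real.exp_log (mgf0_pos hp0 hp1 E f x), le_div_iff₀ (Real.exp_pos _)]
  unfold probEvent mgf0 expVal
  rw [Finset.sum_mul]
  apply Finset.sum_le_sum
  intro F hF
  have hw := edgeWeight_nonneg hp0 hp1 E F
  split_ifs with h
  · exact mul_le_mul_of_nonneg_left (Real.exp_le_exp.2 (hA F (Finset.mem_powerset.1 hF) h)) hw
  · rw [zero_mul]; positivity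

def incB (E : Finset (Sym2 V)) (v : V) : Finset (Sym2 V) := E.filter fun e => v ∈ e

lemma cover_union (F : Finset (Sym2 V)) (τ : ℕ) (hmin : ∀ C : Finset V, IsCoverOf C F → τ ≤ C.card)
    (c0 : Finset V) (h0 : IsCoverOf c0 F) (h0c : c0.card = τ)
    (c : V → Finset V) (S : Finset V)
    (hc : ∀ v ∈ S, IsCoverOf (c v) F ∧ (c v).card = τ ∧ v ∈ c v) :
    ∃ U K : Finset V, K ⊆ U ∧ S ⊆ U ∧ U.card + K.card ≤ 2 * τ ∧
      ∀ u v, s(u, v) ∈ F → u ∉ U → v ∈ K := by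
  induction S using Finset.induction_on with
  | empty =>
    refine ⟨c0, c0, subset_rfl, by simp, by omega, ?_⟩
    intro u v huv hu
    obtain ⟨w, hw, hwe⟩ := h0 _ huv
    rcases Sym2.mem_iff.1 hwe with rfl | rfl
    · exact absurd hw hu
    · exact hw
  | insert a S ha ih =>
    obtain ⟨U, K, hKU, hSU, hcard, hUK⟩ := ih fun v hv => hc v (Finset.mem_insert_of_mem hv)
    obtain ⟨h1, h2, h3⟩ := hc a (Finset.mem_insert_self _ _)
    have hcov : IsCoverOf ((c a ∩ U) ∪ (K \ c a)) F := by
      have key : ∀ u v, s(u, v) ∈ F → u ∈ c a → ∃ w ∈ ((c a ∩ U) ∪ (K \ c a)), w ∈ s(u, v) := by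
        intro u v huv hu
        by_cases huU : u ∈ U
        · exact ⟨u, by simp [hu, huU], by simp⟩
        · have hv := hUK u v huv huU
          refine ⟨v, ?_, by simp⟩
          have := hKU hv
          by_cases hvc : v ∈ c a <;> simp [hvc, hv, this]
      intro e he
      obtain ⟨w, hw, hwe⟩ := h1 e he
      obtain ⟨z, rfl⟩ := Sym2.mem_iff_exists.1 hwe
      exact key w z he hw
    have hτ := hmin _ hcov
    have hle := Finset.card_union_le (c a ∩ U) (K \ c a)
    have e1 := Finset.card_inter_add_card_sdiff (c a) U
    have e2 := Finset.card_inter_add_card_sdiff K (c a)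
    have e3 : (U ∪ c a).card = U.card + (c a \ U).card := by
      rw [← Finset.union_sdiff_self_eq_union, Finset.card_union_of_disjoint Finset.disjoint_sdiff]
    refine ⟨U ∪ c a, K ∩ c a, ?_, ?_, by omega, ?_⟩
    · exact Finset.inter_subset_left.trans (hKU.trans Finset.subset_union_left)
    · intro x hx
      rcases Finset.mem_insert.1 hx with rfl | hx
      · exact Finset.mem_union_right _ h3
      · exact Finset.mem_union_left _ (hSU hx)
    · intro u v huv hu
      rw [Finset.mem_union, not_or] at hu
      refine Finset.mem_inter.2 ⟨hUK u v huv hu.1, ?_⟩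
      obtain ⟨w, hw, hwe⟩ := h1 _ huv
      rcases Sym2.mem_iff.1 hwe with rfl | rfl
      · exact absurd hw hu.2
      · exact hw

lemma sum_drop_le {ι : Type*} [Fintype ι] (n : ℕ) (g : ι → ℕ) (h1 : ∀ i, g i ≤ n)
    (h2 : ∀ i, n ≤ g i + 1) :
    ∑ i, ((n : ℝ) - g i) = ((Finset.univ.filter fun i => g i < n).card : ℝ) := by
  rw [Finset.card_filter]
  push_cast
  apply Finset.sum_congr rfl
  intro i _
  split_ifs with h
  · have : n = g i + 1 := by have := h2 i; omega
    rw [this]; push_cast; ring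
  · have : n = g i := by have := h1 i; omega
    rw [this]; ring

lemma mvc_selfBdd (E : Finset (Sym2 V)) (MVC : Finset (Sym2 V) → Finset V)
    (hM : IsMinCoverFn E MVC) : SelfBdd E (incB E) (fun F => (MVC F).card) 2 := by
  refine ⟨fun i => Finset.filter_subset _ _, ?_, ?_⟩
  · intro e he
    obtain ⟨v, hv⟩ : ∃ v, v ∈ e := ⟨_, Sym2.out_fst_mem e⟩
    exact ⟨v, by simp [incB, he, hv]⟩
  intro F hF
  have hsub : ∀ v, F \ incB E v ⊆ E := fun v => Finset.sdiff_subset.trans hF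
  have hins : ∀ v, IsCoverOf (insert v (MVC (F \ incB E v))) F := by
    intro v e he
    by_cases hv : v ∈ e
    · exact ⟨v, by simp, hv⟩
    · obtain ⟨w, hw, hwe⟩ := (hM _ (hsub v)).1 e (by simp [incB, he, hv])
      exact ⟨w, by simp [hw], hwe⟩
  have hlo : ∀ v, (MVC (F \ incB E v)).card ≤ (MVC F).card := by
    intro v
    apply (hM _ (hsub v)).2
    intro e he
    exact (hM F hF).1 e (Finset.sdiff_subset he)
  have hup : ∀ v, (MVC F).card ≤ (MVC (F \ incB E v)).card + 1 := by
    intro v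
    exact ((hM F hF).2 _ (hins v)).trans (Finset.card_insert_le _ _)
  refine ⟨fun v => ⟨hlo v, hup v⟩, ?_⟩
  rw [sum_drop_le _ _ hlo hup]
  obtain ⟨U, K, _, hSU, hcard, _⟩ := cover_union F (MVC F).card (hM F hF).2 (MVC F) (hM F hF).1 rfl
    (fun v => insert v (MVC (F \ incB E v)))
    (Finset.univ.filter fun v => (MVC (F \ incB E v)).card < (MVC F).card) (by
      intro v hv
      rw [Finset.mem_filter] at hv
      refine ⟨hins v, ?_, by simp⟩
      have h1 := (hM F hF).2 _ (hins v)
      have h2 := Finset.card_insert_le v (MVC (F \ incB E v))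
      omega)
  have := Finset.card_le_card hSU
  have h3 : (Finset.univ.filter fun v => (MVC (F \ incB E v)).card < (MVC F).card).card ≤
    2 * (MVC F).card := by omega
  exact_mod_cast h3

def IsMatch (M : Finset (Sym2 V)) : Prop :=
  ∀ e ∈ M, ∀ e' ∈ M, ∀ v, v ∈ e → v ∈ e' → e = e'

def muF (F : Finset (Sym2 V)) : ℕ := (F.powerset.filter fun M => IsMatch M).sup Finset.card

lemma le_muF {F M : Finset (Sym2 V)} (h : M ⊆ F) (hM : IsMatch M) : M.card ≤ muF F :=
  Finset.le_sup (f := Finset.card) (by simp [h, hM])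

lemma exists_muF (F : Finset (Sym2 V)) : ∃ M ⊆ F, IsMatch M ∧ M.card = muF F := by
  have hne : (F.powerset.filter fun M => IsMatch M).Nonempty := ⟨∅, Finset.mem_filter.2 ⟨by simp, by intro e he; simp at he⟩⟩
  obtain ⟨M, hM, h⟩ := Finset.exists_mem_eq_sup _ hne Finset.card
  rw [Finset.mem_filter, Finset.mem_powerset] at hM
  exact ⟨M, hM.1, hM.2, h.symm⟩

lemma muF_le_cover {F : Finset (Sym2 V)} {C : Finset V} (hC : IsCoverOf C F) :
    muF F ≤ C.card := by
  obtain ⟨M, hMF, hM, hcard⟩ := exists_muF F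
  rw [← hcard]
  have h : ∀ e : Sym2 V, ∃ v, e ∈ M → v ∈ C ∧ v ∈ e := by
    intro e
    by_cases he : e ∈ M
    · obtain ⟨v, h1, h2⟩ := hC e (hMF he)
      exact ⟨v, fun _ => ⟨h1, h2⟩⟩
    · exact ⟨(Quot.out e).1, fun h => absurd h he⟩
  choose g hg using h
  apply Finset.card_le_card_of_injOn g
  · intro e he; exact (hg e he).1
  · intro e he e' he' heq
    exact hM e he e' he' (g e) (hg e he).2 (heq ▸ (hg e' he').2)

lemma cover_le_muF (E : Finset (Sym2 V)) (MVC : Finset (Sym2 V) → Finset V)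
    (hMVC : IsMinCoverFn E MVC) (F) (hF : F ⊆ E) : (MVC F).card ≤ 2 * muF F := by
  obtain ⟨M, hMF, hM, hcard⟩ := exists_muF F
  have hcov : IsCoverOf (M.biUnion fun e => e.toFinset) F := by
    intro e he
    by_contra hcon
    push Not at hcon
    have hno : ∀ v ∈ e, ∀ e' ∈ M, v ∉ e' := by
      intro v hv e' he' hve'
      exact hcon v (Finset.mem_biUnion.2 ⟨e', he', Sym2.mem_toFinset.2 hve'⟩) hv
    have heM : e ∉ M := fun h => hno _ (Sym2.out_fst_mem e) e h (Sym2.out_fst_mem e)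
    have hmat : IsMatch (insert e M) := by
      intro a ha b hb v hva hvb
      rcases Finset.mem_insert.1 ha with h1 | h1 <;> rcases Finset.mem_insert.1 hb with h2 | h2
      · rw [h1, h2]
      · exact absurd hvb (hno v (h1 ▸ hva) b h2)
      · exact absurd hva (hno v (h2 ▸ hvb) a h1)
      · exact hM a h1 b h2 v hva hvb
    have := le_muF (F := F) (Finset.insert_subset he hMF) hmat
    rw [Finset.card_insert_of_notMem heM] at this
    omega
  refine ((hMVC F hF).2 _ hcov).trans ?_
  have h : (M.biUnion fun e => e.toFinset).card ≤ M.card * 2 := by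
    apply Finset.card_biUnion_le_card_mul
    intro e _
    rw [Sym2.card_toFinset]
    split_ifs <;> omega
  omega

lemma muF_selfBdd (E : Finset (Sym2 V)) :
    SelfBdd E (fun e : {e // e ∈ E} => {e.1}) muF 1 := by
  refine ⟨fun i => by simp, fun e he => ⟨⟨e, he⟩, by simp⟩, ?_⟩
  intro F hF
  obtain ⟨M, hMF, hM, hcard⟩ := exists_muF F
  have hlo : ∀ e : {e // e ∈ E}, muF (F \ {e.1}) ≤ muF F := by
    intro e
    obtain ⟨M', h1, h2, h3⟩ := exists_muF (F \ {e.1})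
    rw [← h3]
    exact le_muF (h1.trans Finset.sdiff_subset) h2
  have hsub : ∀ e : {e // e ∈ E}, (M \ {e.1}).card ≤ muF (F \ {e.1}) := by
    intro e
    apply le_muF (Finset.sdiff_subset_sdiff hMF subset_rfl)
    intro a ha b hb
    exact hM a (Finset.sdiff_subset ha) b (Finset.sdiff_subset hb)
  have hup : ∀ e : {e // e ∈ E}, muF F ≤ muF (F \ {e.1}) + 1 := by
    intro e
    have h1 := hsub e
    have h2 := Finset.le_card_sdiff {e.1} M
    rw [Finset.card_singleton] at h2
    omega
  refine ⟨fun e => ⟨hlo e, hup e⟩, ?_⟩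
  rw [sum_drop_le _ _ hlo hup, one_mul, ← hcard]
  have : (Finset.univ.filter fun e : {e // e ∈ E} => muF (F \ {e.1}) < M.card).card ≤ M.card := by
    apply Finset.card_le_card_of_injOn (fun e => e.1)
    · intro e he
      have he := (Finset.mem_filter.1 he).2
      by_contra hcon
      have h1 := hsub e
      rw [Finset.sdiff_eq_self_of_disjoint (Finset.disjoint_singleton_right.2 hcon)] at h1
      omega
    · intro a _ b _ h; exact Subtype.ext h
  exact_mod_cast this

lemma exp_three_le : Real.exp 3 ≤ 20.1 := by
  have h := Real.exp_one_lt_d9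
  have h2 : Real.exp 3 = Real.exp 1 ^ 3 := by rw [← Real.exp_nat_mul]; norm_num
  rw [h2]
  calc Real.exp 1 ^ 3 ≤ (2.7182818286 : ℝ) ^ 3 := by
        apply pow_le_pow_left₀ (Real.exp_pos 1).le h.le
    _ ≤ 20.1 := by norm_num

lemma upper_tail (E : Finset (Sym2 V))
    (p : ℝ) (hp0 : 0 < p) (hp1 : p ≤ 1)
    (MVC : Finset (Sym2 V) → Finset V) (hMVC : IsMinCoverFn E MVC) (t C opt : ℝ) (ht : 0 < t)
    (hC : 7 ≤ C) (hopt : opt = expVal p E (fun F => ((MVC F).card : ℝ))) (hopt0 : 0 ≤ opt) :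
    probEvent p E (fun F => opt + t ≤ ((MVC F).card : ℝ)) ≤
      Real.exp (-t ^ 2 / (4 * C * opt + 2 * t / 3)) := by
  have hden : 28 * opt + 2 * t / 3 ≤ 4 * C * opt + 2 * t / 3 := by nlinarith
  have hden0 : 0 < 28 * opt + 2 * t / 3 := by positivity
  have hmono : t ^ 2 / (4 * C * opt + 2 * t / 3) ≤ t ^ 2 / (28 * opt + 2 * t / 3) :=
    div_le_div_of_nonneg_left (by positivity) hden0 hden
  rcases le_or_gt t (18 * opt) with h | h
  · have hx0 : 0 < t / (2 * opt + t) := by positivity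
    have hx1 : t / (2 * opt + t) < 1 := by rw [div_lt_one (by positivity)]; linarith
    have hL := upper_two hp0 hp1 E (incB E) _ (mvc_selfBdd E MVC hMVC) _ hx0 hx1
    rw [← hopt] at hL
    refine (markov_exp hp0 hp1 E (fun F => (MVC F).card) _ (t / (2 * opt + t))
      (t / (2 * opt + t) * (opt + t)) ?_).trans ?_
    · intro F _ hA
      exact mul_le_mul_of_nonneg_left hA hx0.le
    · apply Real.exp_le_exp.2
      have hop : 0 < opt := by linarith
      have e1 : opt * (t / (2 * opt + t) / (1 - t / (2 * opt + t))) -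
          t / (2 * opt + t) * (opt + t) = - (t ^ 2 / (4 * opt + 2 * t)) := by
        have h1 : 1 - t / (2 * opt + t) = 2 * opt / (2 * opt + t) := by field_simp; ring
        rw [h1]
        field_simp
        ring
      have e2 : t ^ 2 / (28 * opt + 2 * t / 3) ≤ t ^ 2 / (4 * opt + 2 * t) :=
        div_le_div_of_nonneg_left (by positivity) (by positivity) (by linarith)
      rw [neg_div]
      linarith
  · have hL := upper_one hp0 hp1 E _ muF (muF_selfBdd E) 3 (by norm_num)
    have hmu : expVal p E (fun F => (muF F : ℝ)) ≤ opt := by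
      rw [hopt]
      apply expVal_mono hp0 hp1
      intro F hF
      exact_mod_cast muF_le_cover (hMVC F hF).1
    refine (markov_exp hp0 hp1 E muF _ 3 (3 / 2 * (opt + t)) ?_).trans ?_
    · intro F hF hA
      have h1 : ((MVC F).card : ℝ) ≤ 2 * muF F := by
        exact_mod_cast cover_le_muF E MVC hMVC F hF
      linarith
    · apply Real.exp_le_exp.2
      have h3 := exp_three_le
      have h4 : 1 ≤ Real.exp 3 := Real.one_le_exp (by norm_num)
      have h5 : expVal p E (fun F => (muF F : ℝ)) * (Real.exp 3 - 1) ≤ opt * 19.1 := by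
        apply mul_le_mul hmu (by linarith) (by linarith) hopt0
      have h6 : t ^ 2 / (28 * opt + 2 * t / 3) ≤ 3 / 2 * (opt + t) - opt * 19.1 := by
        rw [div_le_iff₀ hden0]
        nlinarith [mul_nonneg hopt0 (by linarith : 0 ≤ t - 18 * opt)]
      rw [neg_div]
      linarith

lemma lower_tail (E : Finset (Sym2 V))
    (p : ℝ) (hp0 : 0 < p) (hp1 : p ≤ 1)
    (MVC : Finset (Sym2 V) → Finset V) (hMVC : IsMinCoverFn E MVC) (t C opt : ℝ) (ht : 0 < t)
    (hC : 7 ≤ C) (hopt : opt = expVal p E (fun F => ((MVC F).card : ℝ))) (hopt0 : 0 ≤ opt) :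
    probEvent p E (fun F => ((MVC F).card : ℝ) ≤ opt - t) ≤
      Real.exp (-t ^ 2 / (4 * C * opt + 2 * t / 3)) := by
  rcases le_or_gt t opt with h | h
  · have hop : 0 < opt := by linarith
    have hx0 : 0 < t / (4 * opt) := by positivity
    have hx1 : t / (4 * opt) < 1 := by rw [div_lt_one (by positivity)]; linarith
    have hL := lower_two hp0 hp1 E (incB E) _ (mvc_selfBdd E MVC hMVC) _ hx0 hx1
    rw [← hopt] at hL
    refine (markov_exp hp0 hp1 E (fun F => (MVC F).card) _ (-(t / (4 * opt)))
      (-(t / (4 * opt)) * (opt - t)) ?_).trans ?_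
    · intro F _ hA
      have := mul_le_mul_of_nonneg_left hA hx0.le
      linarith
    · apply Real.exp_le_exp.2
      set x := t / (4 * opt) with hx
      have e0 : t = 4 * opt * x := by rw [hx]; field_simp
      have e1 : x - 2 * x ^ 2 ≤ x / (1 + 2 * x) := by
        rw [le_div_iff₀ (by linarith)]
        have : 0 < x ^ 3 := by positivity
        nlinarith
      have e2 := mul_le_mul_of_nonneg_left e1 hopt0
      have e3 : t ^ 2 / (4 * C * opt + 2 * t / 3) ≤ t ^ 2 / (8 * opt) :=
        div_le_div_of_nonneg_left (by positivity) (by positivity) (by nlinarith)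
      have e4 : t ^ 2 / (8 * opt) = 2 * opt * x ^ 2 := by
        rw [e0]; field_simp; ring
      rw [neg_div]
      have e5 : x * t = 4 * opt * x ^ 2 := by rw [e0]; ring
      nlinarith
  · have : probEvent p E (fun F => ((MVC F).card : ℝ) ≤ opt - t) = 0 := by
      unfold probEvent
      apply Finset.sum_eq_zero
      intro F _
      rw [if_neg]
      have : (0 : ℝ) ≤ ((MVC F).card : ℝ) := by positivity
      intro h'
      linarith
    rw [this]
    positivity

/-- Theorem 1.2 / concentration for minimum vertex cover.
Let `Z = |MVC(G*)|` and `opt = E[Z]`. Then for every `t ≥ 0`,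
`Pr[|Z - opt| ≥ t] ≤ 2·exp(−t²/(4C·opt + 2t/3))` where `C = 2(e/(e−1) + 2) < 8`. -/
theorem mvc_concentration
    (G : SimpleGraph V) [DecidableRel G.Adj]
    (p : ℝ) (hp0 : 0 < p) (hp1 : p ≤ 1)
    (MVC : Finset (Sym2 V) → Finset V)
    (hMVC : IsMinCoverFn G.edgeFinset MVC)
    (opt : ℝ) (hopt : opt = optVal p G.edgeFinset MVC)
    (C : ℝ) (hC : C = 2 * (Real.exp 1 / (Real.exp 1 - 1) + 2))
    (t : ℝ) (ht : 0 ≤ t) :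
    probEvent p G.edgeFinset (fun F => t ≤ |((MVC F).card : ℝ) - opt|) ≤
      2 * Real.exp (-t ^ 2 / (4 * C * opt + 2 * t / 3)) := by
  have hopt0 : 0 ≤ opt := by
    rw [hopt, optVal, ← expVal_const p G.edgeFinset 0]
    apply expVal_mono hp0 hp1
    intro F _
    positivity
  have hC7 : 7 ≤ C := by
    have h1 := Real.exp_one_lt_three
    have h2 := Real.exp_one_gt_two
    have h3 : 3 / 2 ≤ Real.exp 1 / (Real.exp 1 - 1) := by
      rw [le_div_iff₀ (by linarith)]; linarith
    rw [hC]; linarith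
  rcases ht.eq_or_lt with h0 | h0
  · subst h0
    have h1 : probEvent p G.edgeFinset (fun F => 0 ≤ |((MVC F).card : ℝ) - opt|) = 1 := by
      rw [← expVal_const p G.edgeFinset 1]
      unfold probEvent expVal
      apply Finset.sum_congr rfl
      intro F _
      rw [if_pos (abs_nonneg _), mul_one]
    rw [h1]
    norm_num
  have hu := upper_tail G.edgeFinset p hp0 hp1 MVC hMVC t C opt h0 hC7 hopt hopt0
  have hl := lower_tail G.edgeFinset p hp0 hp1 MVC hMVC t C opt h0 hC7 hopt hopt0
  have hs : probEvent p G.edgeFinset (fun F => t ≤ |((MVC F).card : ℝ) - opt|) ≤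
      probEvent p G.edgeFinset (fun F => opt + t ≤ ((MVC F).card : ℝ)) +
      probEvent p G.edgeFinset (fun F => ((MVC F).card : ℝ) ≤ opt - t) := by
    unfold probEvent
    rw [← Finset.sum_add_distrib]
    apply Finset.sum_le_sum
    intro F _
    have hw := edgeWeight_nonneg hp0 hp1 G.edgeFinset F
    by_cases h : t ≤ |((MVC F).card : ℝ) - opt|
    · rw [if_pos h]
      rcases le_abs.1 h with h' | h'
      · rw [if_pos (by linarith : opt + t ≤ ((MVC F).card : ℝ))]
        have : 0 ≤ (if ((MVC F).card : ℝ) ≤ opt - t then edgeWeight p G.edgeFinset F else 0) := by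
          split_ifs <;> simp [hw]
        linarith
      · rw [if_pos (by linarith : ((MVC F).card : ℝ) ≤ opt - t)]
        have : 0 ≤ (if opt + t ≤ ((MVC F).card : ℝ) then edgeWeight p G.edgeFinset F else 0) := by
          split_ifs <;> simp [hw]
        linarith
    · rw [if_neg h]
      apply add_nonneg <;> split_ifs <;> simp [hw]
  linarith
end
end

section
/- Let Y_0, …, Y_N be a martingale with respect to the sequence of random variables X_1, …, X_N. Suppose the differences D_k = Y_k − Y_{k−1} satisfy |D_k| ≤ R almost surely for all k ≥ 1, and suppose that almost surely W = Σ_{k=1}^N Var(D_k | X_1,…,X_{k−1}) ≤ σ². Then for any t ≥ 0, Pr[|Y_N − Y_0| ≥ t] ≤ 2·exp(−t²/(2(σ² + R·t/3))). -/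
open MeasureTheory

noncomputable section

lemma fr_pos (x : ℝ) (hx : 0 ≤ x) : (3 - x) * Real.exp x ≤ 3 + 2 * x + x ^ 2 / 2 := by
  have h0 : ∀ y : ℝ, 0 ≤ y → (1 - y) * Real.exp y ≤ 1 := by
    intro y hy
    have h1 := Real.add_one_le_exp (-y)
    have h2 : Real.exp (-y) * Real.exp y = 1 := by rw [← Real.exp_add]; simp
    nlinarith [Real.exp_pos y]
  have mono : ∀ f f' : ℝ → ℝ, (∀ y, HasDerivAt f (f' y) y) → (∀ y, 0 ≤ y → 0 ≤ f' y) →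
      ∀ y, 0 ≤ y → f 0 ≤ f y := by
    intro f f' hf hf' y hy
    have : MonotoneOn f (Set.Ici 0) := by
      apply monotoneOn_of_deriv_nonneg (convex_Ici 0)
      · exact fun z _ => (hf z).continuousAt.continuousWithinAt
      · exact fun z _ => (hf z).differentiableAt.differentiableWithinAt
      · intro z hz
        rw [(hf z).deriv]
        rw [interior_Ici] at hz
        exact hf' z (le_of_lt hz)
    exact this (Set.mem_Ici.2 le_rfl) hy hy
  have h1 : ∀ y : ℝ, 0 ≤ y → (2 - y) * Real.exp y ≤ 2 + y := by
    intro y hy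
    have := mono (fun y => 2 + y - (2 - y) * Real.exp y) (fun y => 1 - (1 - y) * Real.exp y)
      (fun z => by
        have a := ((hasDerivAt_id z).const_add 2).sub
          (((hasDerivAt_id z).const_sub 2).mul (Real.hasDerivAt_exp z))
        refine HasDerivAt.congr_deriv (f := _) a ?_
        simp; ring)
      (fun z hz => by linarith [h0 z hz]) y hy
    simp at this
    linarith
  have := mono (fun y => 3 + 2 * y + y ^ 2 / 2 - (3 - y) * Real.exp y)
      (fun y => 2 + y - (2 - y) * Real.exp y)
      (fun z => by
        have a := ((((hasDerivAt_id z).const_mul 2).const_add 3).add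
          (((hasDerivAt_id z).pow 2).div_const 2)).sub
          (((hasDerivAt_id z).const_sub 3).mul (Real.hasDerivAt_exp z))
        refine HasDerivAt.congr_deriv (f := _) a ?_
        simp; ring)
      (fun z hz => by linarith [h1 z hz]) x hx
  simp at this
  linarith

lemma fr_exp (x b : ℝ) (hx : |x| ≤ b) (hb : b < 3) :
    Real.exp x ≤ 1 + x + x ^ 2 / (2 * (1 - b / 3)) := by
  obtain ⟨hx1, hx2⟩ := abs_le.1 hx
  have hpos : 0 < 2 * (1 - b / 3) := by linarith
  rcases le_total 0 x with h | h
  · have h1 := fr_pos x h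
    have hp : 0 < 2 * (1 - x / 3) := by linarith
    have h2 : x ^ 2 / (2 * (1 - x / 3)) ≤ x ^ 2 / (2 * (1 - b / 3)) := by
      apply div_le_div_of_nonneg_left (sq_nonneg _) hpos; linarith
    have h3 : Real.exp x - 1 - x ≤ x ^ 2 / (2 * (1 - x / 3)) := by
      rw [le_div_iff₀ hp]; nlinarith
    linarith
  · have h1 : Real.exp x ≤ 1 + x + x ^ 2 / 2 := by
      have h := Real.quadratic_le_exp_of_nonneg (x := -x) (by linarith)
      have h2 : Real.exp x * Real.exp (-x) = 1 := by rw [← Real.exp_add]; simp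
      have h3 : 0 < Real.exp x := Real.exp_pos x
      have h4 : Real.exp x * (1 + -x + (-x)^2/2) ≤ 1 := by
        exact (mul_le_mul_of_nonneg_left h h3.le).trans h2.le
      have h5 : (1 + x + x ^ 2 / 2) * (1 + -x + (-x)^2/2) = 1 + x ^ 4 / 4 := by ring
      have h6 : 0 < (1 + -x + (-x)^2/2) := by nlinarith
      by_contra hc
      push Not at hc
      have := mul_lt_mul_of_pos_right hc h6
      nlinarith [sq_nonneg (x^2)]
    have h2 : x ^ 2 / 2 ≤ x ^ 2 / (2 * (1 - b / 3)) := by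
      apply div_le_div_of_nonneg_left (sq_nonneg _) hpos; linarith
    linarith

lemma fr_step {Ω : Type*} [m0 : MeasurableSpace Ω] (μ : Measure Ω) [IsProbabilityMeasure μ]
    (m : MeasurableSpace Ω) (hm : m ≤ m0) (A D : Ω → ℝ) (l c R C : ℝ) (hc : 0 ≤ c)
    (hA : AEStronglyMeasurable[m] A μ) (hA0 : ∀ ω, 0 ≤ A ω) (hAC : ∀ᵐ ω ∂μ, A ω ≤ C)
    (hDm : AEStronglyMeasurable[m0] D μ)
    (hD : ∀ᵐ ω ∂μ, |D ω| ≤ R) (hD0 : μ[D | m] =ᵐ[μ] 0)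
    (hexp : ∀ x, |x| ≤ R → Real.exp (l * x) ≤ 1 + l * x + c * x ^ 2) :
    ∫ ω, A ω * Real.exp (l * D ω) ∂μ
      ≤ ∫ ω, A ω * Real.exp (c * (μ[fun ω => D ω ^ 2 | m]) ω) ∂μ
        ∨ ¬ Integrable (fun ω => A ω * Real.exp (c * (μ[fun ω => D ω ^ 2 | m]) ω)) μ := by
  by_cases hI : Integrable (fun ω => A ω * Real.exp (c * (μ[fun ω => D ω ^ 2 | m]) ω)) μ
  swap
  · exact Or.inr hI
  left
  have hA' : AEStronglyMeasurable[m0] A μ := hA.mono hm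
  have hAb : ∀ᵐ ω ∂μ, ‖A ω‖ ≤ C := by
    filter_upwards [hAC] with ω h
    rw [Real.norm_eq_abs, abs_of_nonneg (hA0 ω)]; exact h
  have hAi : Integrable A μ := Integrable.of_bound hA' C hAb
  have hDi : Integrable D μ := Integrable.of_bound hDm R (by simpa using hD)
  have hD2i : Integrable (fun ω => D ω ^ 2) μ := by
    refine Integrable.of_bound (hDm.pow 2) (R ^ 2) ?_
    filter_upwards [hD] with ω h
    rw [Real.norm_eq_abs, abs_pow]
    exact pow_le_pow_left₀ (abs_nonneg _) h 2
  have key : ∀ g : Ω → ℝ, Integrable g μ → Integrable (fun ω => A ω * g ω) μ ∧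
      Integrable (fun ω => A ω * (μ[g | m]) ω) μ ∧
      ∫ ω, A ω * g ω ∂μ = ∫ ω, A ω * (μ[g | m]) ω ∂μ := by
    intro g hg
    have h1 : Integrable (A * g) μ := hg.bdd_mul hA' hAb
    refine ⟨h1, integrable_condExp.bdd_mul hA' hAb, ?_⟩
    have h2 := condExp_mul_of_aestronglyMeasurable_left hA h1 hg
    have h3 := integral_condExp (μ := μ) (f := A * g) hm
    rw [integral_congr_ae h2] at h3
    exact h3.symm
  obtain ⟨a1, a2, a3⟩ := key D hDi
  obtain ⟨b1, b2, b3⟩ := key _ hD2i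
  have a4 : ∫ ω, A ω * (μ[D | m]) ω ∂μ = 0 := by
    rw [← integral_zero Ω ℝ (μ := μ)]
    apply integral_congr_ae
    filter_upwards [hD0] with ω h
    simp [h]
  have hlei : Integrable (fun ω => A ω + l * (A ω * D ω) + c * (A ω * D ω ^ 2)) μ :=
    (hAi.add (a1.const_mul l)).add (b1.const_mul c)
  calc ∫ ω, A ω * Real.exp (l * D ω) ∂μ
      ≤ ∫ ω, (A ω + l * (A ω * D ω) + c * (A ω * D ω ^ 2)) ∂μ := by
        apply integral_mono_of_nonneg _ hlei
        · filter_upwards [hD] with ω h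
          have := mul_le_mul_of_nonneg_left (hexp _ h) (hA0 ω)
          linarith
        · exact Filter.Eventually.of_forall fun ω => mul_nonneg (hA0 ω) (Real.exp_pos _).le
    _ = ∫ ω, (A ω + c * (A ω * (μ[fun ω => D ω ^ 2 | m]) ω)) ∂μ := by
        have hh : Integrable (fun ω => A ω + l * (A ω * D ω)) μ := hAi.add (a1.const_mul l)
        rw [integral_add hh (b1.const_mul c),
          integral_add hAi (a1.const_mul l), integral_add hAi (b2.const_mul c),
          integral_const_mul, integral_const_mul, integral_const_mul, a3, a4, b3]
        ring
    _ ≤ _ := by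
        apply integral_mono (hAi.add (b2.const_mul c)) hI
        intro ω
        have := mul_le_mul_of_nonneg_left
          (Real.add_one_le_exp (c * (μ[fun ω => D ω ^ 2 | m]) ω)) (hA0 ω)
        simp only [Pi.add_apply]
        linarith

lemma fr_one {Ω : Type*} [m0 : MeasurableSpace Ω] (μ : Measure Ω) [IsProbabilityMeasure μ]
    (N : ℕ) (Y : ℕ → Ω → ℝ) (ℱ : ℕ → MeasurableSpace Ω) (hmono : Monotone ℱ)
    (hle : ∀ k, ℱ k ≤ m0)
    (hmeas : ∀ k ≤ N, AEStronglyMeasurable[ℱ k] (Y k) μ)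
    (R s t l c : ℝ) (hl : 0 ≤ l) (hc : 0 ≤ c)
    (hR : ∀ k < N, ∀ᵐ ω ∂μ, |Y (k + 1) ω - Y k ω| ≤ R)
    (hD0 : ∀ k < N, μ[fun ω => Y (k + 1) ω - Y k ω | ℱ k] =ᵐ[μ] 0)
    (hW : ∀ᵐ ω ∂μ, ∑ k ∈ Finset.range N,
      (μ[fun ω => (Y (k + 1) ω - Y k ω) ^ 2 | ℱ k]) ω ≤ s)
    (hexp : ∀ x, |x| ≤ R → Real.exp (l * x) ≤ 1 + l * x + c * x ^ 2) :
    μ.real {ω | t ≤ Y N ω - Y 0 ω} ≤ Real.exp (-(l * t) + c * s) := by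
  set V : ℕ → Ω → ℝ := fun k => μ[fun ω => (Y (k + 1) ω - Y k ω) ^ 2 | ℱ k] with hV
  have hV0 : ∀ᵐ ω ∂μ, ∀ k, 0 ≤ V k ω := by
    rw [ae_all_iff]
    intro k
    exact condExp_nonneg (Filter.Eventually.of_forall fun ω => sq_nonneg _)
  have hB : ∀ k ≤ N, ∀ᵐ ω ∂μ, |Y k ω - Y 0 ω| ≤ k * R := by
    intro k
    induction k with
    | zero => simp
    | succ k ih =>
      intro hk
      filter_upwards [ih (by omega), hR k (by omega)] with ω h1 h2
      have := abs_add_le (Y (k+1) ω - Y k ω) (Y k ω - Y 0 ω)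
      rw [sub_add_sub_cancel] at this
      push_cast
      linarith
  -- general weights
  let G : ℕ → ℕ → Ω → ℝ := fun k j ω =>
    Real.exp (l * (Y k ω - Y 0 ω) - c * ∑ i ∈ Finset.range j, V i ω)
  have hGm : ∀ k ≤ N, ∀ j ≤ k + 1, AEStronglyMeasurable[ℱ k] (G k j) μ := by
    intro k hk j hj
    have h1 : AEStronglyMeasurable[ℱ k] (Y 0) μ :=
      (hmeas 0 (Nat.zero_le _)).mono (hmono (Nat.zero_le k))
    have h2 : AEStronglyMeasurable[ℱ k] (fun ω => ∑ i ∈ Finset.range j, V i ω) μ := by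
      apply StronglyMeasurable.aestronglyMeasurable
      apply Finset.stronglyMeasurable_fun_sum
      intro i hi
      exact stronglyMeasurable_condExp.mono (hmono (by have := Finset.mem_range.1 hi; omega))
    exact Real.continuous_exp.comp_aestronglyMeasurable
      ((((hmeas k hk).sub h1).const_mul l).sub (h2.const_mul c))
  have hGb : ∀ k ≤ N, ∀ j, ∀ᵐ ω ∂μ, G k j ω ≤ Real.exp (l * (k * R)) := by
    intro k hk j
    filter_upwards [hV0, hB k hk] with ω h1 h2
    apply Real.exp_le_exp.2
    have h3 : 0 ≤ ∑ i ∈ Finset.range j, V i ω := Finset.sum_nonneg fun i _ => h1 i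
    have h4 := mul_le_mul_of_nonneg_left ((le_abs_self _).trans h2) hl
    have h5 := mul_nonneg hc h3
    linarith
  have hGi : ∀ k ≤ N, ∀ j ≤ k + 1, Integrable (G k j) μ := by
    intro k hk j hj
    refine Integrable.of_bound ((hGm k hk j hj).mono (hle k)) (Real.exp (l * (k * R))) ?_
    filter_upwards [hGb k hk j] with ω h
    rw [Real.norm_eq_abs, abs_of_pos (Real.exp_pos _)]
    exact h
  have hE : ∀ k ≤ N, ∫ ω, G k k ω ∂μ ≤ 1 := by
    intro k
    induction k with
    | zero => intro _; simp [G]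
    | succ k ih =>
      intro hk
      have hk' : k ≤ N := by omega
      have e1 : ∀ ω, G k (k+1) ω * Real.exp (c * V k ω) = G k k ω := by
        intro ω
        simp only [G]
        rw [← Real.exp_add, Finset.sum_range_succ]
        congr 1; ring
      have e2 : ∀ ω, G (k+1) (k+1) ω = G k (k+1) ω * Real.exp (l * (Y (k + 1) ω - Y k ω)) := by
        intro ω
        simp only [G]
        rw [← Real.exp_add]
        congr 1; ring
      have st := fr_step μ (ℱ k) (hle k) (G k (k+1)) (fun ω => Y (k + 1) ω - Y k ω) l c R _ hc
        (hGm k hk' _ le_rfl) (fun ω => (Real.exp_pos _).le) (hGb k hk' (k+1))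
        (((hmeas (k+1) hk).mono (hle _)).sub ((hmeas k hk').mono (hle _)))
        (hR k (by omega)) (hD0 k (by omega)) hexp
      change ∫ ω, G k (k+1) ω * Real.exp (l * (Y (k + 1) ω - Y k ω)) ∂μ
        ≤ ∫ ω, G k (k+1) ω * Real.exp (c * V k ω) ∂μ
        ∨ ¬ Integrable (fun ω => G k (k+1) ω * Real.exp (c * V k ω)) μ at st
      simp only [e1, ← e2] at st
      rcases st with st | st
      · exact st.trans (ih hk')
      · exact absurd (hGi k hk' k (by omega)) st
  have hmk := mul_meas_ge_le_integral_of_nonneg (μ := μ) (f := G N N)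
    (Filter.Eventually.of_forall fun ω => (Real.exp_pos _).le) (hGi N le_rfl N (by omega))
    (Real.exp (l * t - c * s))
  have hsub : μ.real {ω | t ≤ Y N ω - Y 0 ω} ≤ μ.real {ω | Real.exp (l * t - c * s) ≤ G N N ω} := by
    apply ENNReal.toReal_mono (measure_ne_top _ _)
    apply measure_mono_ae
    filter_upwards [hW] with ω h1 h2
    apply Real.exp_le_exp.2
    have h3 := mul_le_mul_of_nonneg_left (show t ≤ Y N ω - Y 0 ω from h2) hl
    have h4 := mul_le_mul_of_nonneg_left h1 hc
    linarith
  have hfin : Real.exp (l * t - c * s) * μ.real {ω | t ≤ Y N ω - Y 0 ω} ≤ 1 :=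
    (mul_le_mul_of_nonneg_left hsub (Real.exp_pos _).le).trans (hmk.trans (hE N le_rfl))
  have : Real.exp (-(l * t) + c * s) = (Real.exp (l * t - c * s))⁻¹ := by
    rw [← Real.exp_neg]; congr 1; ring
  rw [this, ← one_div, le_div_iff₀ (Real.exp_pos _)]
  linarith

/-- Choice of the parameter. -/
lemma fr_param (R q t : ℝ) (hR : 0 ≤ R) (hq : 0 ≤ q) (ht : 0 ≤ t) (hpos : 0 < q + R * t / 3) :
    ∃ l c : ℝ, 0 ≤ l ∧ 0 ≤ c ∧
      (∀ x, |x| ≤ R → Real.exp (l * x) ≤ 1 + l * x + c * x ^ 2) ∧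
      -(l * t) + c * q ≤ -t ^ 2 / (2 * (q + R * t / 3)) := by
  have gen : ∀ l : ℝ, 0 ≤ l → l * R < 3 → 0 ≤ l ^ 2 / (2 * (1 - l * R / 3)) ∧
      ∀ x, |x| ≤ R → Real.exp (l * x) ≤ 1 + l * x + l ^ 2 / (2 * (1 - l * R / 3)) * x ^ 2 := by
    intro l hl h
    refine ⟨div_nonneg (sq_nonneg _) (by linarith), fun x hx => ?_⟩
    have := fr_exp (l * x) (l * R) (by
      rw [abs_mul, abs_of_nonneg hl]; exact mul_le_mul_of_nonneg_left hx hl) h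
    convert this using 2
    ring
  rcases hq.eq_or_lt with h0 | h0
  · subst h0
    have hRp : 0 < R := by
      rcases hR.eq_or_lt with h | h
      · subst h; simp at hpos
      · exact h
    have htp : 0 < t := by
      rcases ht.eq_or_lt with h | h
      · subst h; simp at hpos
      · exact h
    obtain ⟨g1, g2⟩ := gen (3 / (2 * R)) (by positivity) (by field_simp; norm_num)
    refine ⟨_, _, by positivity, g1, g2, le_of_eq ?_⟩
    field_simp
    ring
  · set p := q + R * t / 3 with hp
    have e : 1 - t / p * R / 3 = q / p := by
      field_simp
      rw [hp]; ring
    have hlt : t / p * R < 3 := by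
      have : 0 < q / p := by positivity
      linarith
    obtain ⟨g1, g2⟩ := gen (t / p) (by positivity) hlt
    refine ⟨_, _, by positivity, g1, g2, le_of_eq ?_⟩
    rw [e]
    field_simp
    ring

/-- Freedman's inequality, Theorem 5.2.
Let `Y_0, …, Y_N` be a martingale with respect to the sequence of random variables
`X_1, …, X_N`, i.e. each `Y_k` is a function of `X_1, …, X_k` (measurable with respect to
the σ-algebra `ℱ k` generated by `X_1, …, X_k`), each `Y_k` is integrable, and
`E[Y_k | X_1, …, X_{k−1}] = Y_{k−1}`. Suppose the differences `D_k = Y_k − Y_{k−1}`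
satisfy `|D_k| ≤ R` almost surely for all `k ≥ 1`, and suppose that almost surely
`W = Σ_{k=1}^N Var(D_k | X_1,…,X_{k−1}) ≤ σ²`. Then for any `t ≥ 0`,
`Pr[|Y_N − Y_0| ≥ t] ≤ 2·exp(−t²/(2(σ² + R·t/3)))`. -/
theorem freedman_inequality
    {Ω : Type*} [m0 : MeasurableSpace Ω] (μ : Measure Ω) [IsProbabilityMeasure μ]
    (N : ℕ) (X Y : ℕ → Ω → ℝ)
    (ℱ : ℕ → MeasurableSpace Ω)
    (hℱ : ∀ k, ℱ k = ⨆ i ∈ Finset.Icc 1 k, MeasurableSpace.comap (X i) Real.measurableSpace)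
    (hle : ∀ k, ℱ k ≤ m0)
    (hmeas : ∀ k, 1 ≤ k → k ≤ N → StronglyMeasurable[ℱ k] (Y k))
    (hint : ∀ k ≤ N, Integrable (Y k) μ)
    (hmart : ∀ k, 1 ≤ k → k ≤ N → μ[Y k | ℱ (k - 1)] =ᵐ[μ] Y (k - 1))
    (R σ : ℝ)
    (hR : ∀ k, 1 ≤ k → k ≤ N → ∀ᵐ ω ∂μ, |Y k ω - Y (k - 1) ω| ≤ R)
    (hW : ∀ᵐ ω ∂μ,
      ∑ k ∈ Finset.Icc 1 N,
        ((μ[fun ω' => (Y k ω' - Y (k - 1) ω') ^ 2 | ℱ (k - 1)]) ω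
          - ((μ[fun ω' => Y k ω' - Y (k - 1) ω' | ℱ (k - 1)]) ω) ^ 2) ≤ σ ^ 2)
    (t : ℝ) (ht : 0 ≤ t) :
    (μ {ω | t ≤ |Y N ω - Y 0 ω|}).toReal ≤
      2 * Real.exp (-t ^ 2 / (2 * (σ ^ 2 + R * t / 3))) := by
  have hmono : Monotone ℱ := by
    intro a b hab
    rw [hℱ, hℱ]
    exact biSup_mono fun i hi => by
      simp only [Finset.mem_Icc] at hi ⊢; omega
  have hle1 : ∀ s : Set Ω, (μ s).toReal ≤ 1 := fun s => measureReal_le_one (μ := μ) (s := s)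
  rcases Nat.eq_zero_or_pos N with hN | hN
  · subst hN
    rcases ht.eq_or_lt with h | h
    · subst h
      refine (hle1 _).trans ?_
      simp
    · have : {ω | t ≤ |Y 0 ω - Y 0 ω|} = ∅ := by
        ext ω; simp [h]
      rw [this]
      simp
      positivity
  have hR0 : 0 ≤ R := by
    obtain ⟨ω, h⟩ := (hR 1 le_rfl hN).exists
    exact (abs_nonneg _).trans h
  have hp0 : 0 ≤ σ ^ 2 + R * t / 3 := by positivity
  rcases hp0.eq_or_lt with hz | hp
  · rw [← hz]
    refine (hle1 _).trans ?_
    simp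
  obtain ⟨l, c, hl, hc, hexp, hfin⟩ := fr_param R (σ ^ 2) t hR0 (sq_nonneg _) ht hp
  have hmeas' : ∀ k ≤ N, AEStronglyMeasurable[ℱ k] (Y k) μ := by
    intro k hk
    rcases Nat.eq_zero_or_pos k with h | h
    · subst h
      exact ⟨_, stronglyMeasurable_condExp, (hmart 1 le_rfl hN).symm⟩
    · exact (hmeas k h hk).aestronglyMeasurable
  have hRk : ∀ k < N, ∀ᵐ ω ∂μ, |Y (k + 1) ω - Y k ω| ≤ R := fun k hk =>
    hR (k + 1) (by omega) hk
  have hD0 : ∀ k < N, μ[fun ω => Y (k + 1) ω - Y k ω | ℱ k] =ᵐ[μ] 0 := by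
    intro k hk
    have h1 := condExp_sub (hint (k+1) hk) (hint k hk.le) (ℱ k)
    have h2 := hmart (k + 1) (by omega) hk
    rw [Nat.add_sub_cancel] at h2
    have h3 := condExp_of_aestronglyMeasurable' (hle k) (hmeas' k hk.le) (hint k hk.le)
    refine h1.trans ?_
    filter_upwards [h2, h3] with ω h2 h3
    simp [h2, h3]
  have hW' : ∀ᵐ ω ∂μ, ∑ k ∈ Finset.range N,
      (μ[fun ω => (Y (k + 1) ω - Y k ω) ^ 2 | ℱ k]) ω ≤ σ ^ 2 := by
    have hall : ∀ᵐ ω ∂μ, ∀ k, k < N → (μ[fun ω => Y (k + 1) ω - Y k ω | ℱ k]) ω = 0 := by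
      rw [ae_all_iff]
      intro k
      by_cases hk : k < N
      · filter_upwards [hD0 k hk] with ω h _ using h
      · exact Filter.Eventually.of_forall fun ω h => absurd h hk
    filter_upwards [hW, hall] with ω h1 h2
    refine le_trans (le_of_eq ?_) h1
    have hs : ∀ (f : ℕ → ℝ) (n : ℕ),
        ∑ k ∈ Finset.Icc 1 n, f k = ∑ k ∈ Finset.range n, f (k + 1) := by
      intro f n
      induction n with
      | zero => simp
      | succ n ih => rw [Finset.sum_Icc_succ_top (by omega), Finset.sum_range_succ, ih]
    rw [hs]
    apply Finset.sum_congr rfl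
    intro k hk
    have := h2 k (Finset.mem_range.1 hk)
    simp only [Nat.add_sub_cancel]
    rw [this]
    ring
  have u1 := fr_one μ N Y ℱ hmono hle hmeas' R (σ ^ 2) t l c hl hc hRk hD0 hW' hexp
  have u2 := fr_one μ N (fun k ω => - Y k ω) ℱ hmono hle (fun k hk => (hmeas' k hk).neg)
    R (σ ^ 2) t l c hl hc
    (fun k hk => by
      filter_upwards [hRk k hk] with ω h
      rw [← abs_neg]; convert h using 2; ring)
    (fun k hk => by
      have e : (fun ω => -Y (k + 1) ω - -Y k ω) = -(fun ω => Y (k + 1) ω - Y k ω) := by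
        ext ω; simp; ring
      rw [e]
      refine (condExp_neg _ _).trans ?_
      filter_upwards [hD0 k hk] with ω h
      simp [h])
    (by
      have e : ∀ k, (fun ω => (-Y (k + 1) ω - -Y k ω) ^ 2)
          = (fun ω => (Y (k + 1) ω - Y k ω) ^ 2) := by
        intro k; ext ω; ring
      simp only [e]
      exact hW') hexp
  have hsub : {ω | t ≤ |Y N ω - Y 0 ω|} ⊆
      {ω | t ≤ Y N ω - Y 0 ω} ∪ {ω | t ≤ -Y N ω - -Y 0 ω} := by
    intro ω h
    rcases le_abs.1 (show t ≤ |Y N ω - Y 0 ω| from h) with h | h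
    · exact Or.inl h
    · right
      change t ≤ _
      linarith
  have h1 : μ.real {ω | t ≤ |Y N ω - Y 0 ω|} ≤ _ :=
    (measureReal_mono hsub).trans (measureReal_union_le _ _)
  have h2 := Real.exp_le_exp.2 hfin
  change μ.real {ω | t ≤ |Y N ω - Y 0 ω|} ≤ _
  linarith
end
end

section
/- For any ε ≤ 1/4, the set L = {v ∈ V : Pr[v ∈ MVC(G*)] ≥ 1 − 2ε} satisfies E[|L \ MVC(G*)|] ≤ 4ε·opt. -/
open Finset

noncomputable section
open scoped Classical

variable {V : Type*} [Fintype V] [DecidableEq V]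

theorem aux_total (p : ℝ) (E : Finset (Sym2 V)) : ∑ F ∈ E.powerset, edgeWeight p E F = 1 := by
  have h := Finset.sum_pow_mul_eq_add_pow p (1 - p) E
  rw [show p + (1 - p) = 1 by ring, one_pow] at h
  rw [← h]
  apply Finset.sum_congr rfl
  intro F hF
  rw [edgeWeight, Finset.card_sdiff_of_subset (Finset.mem_powerset.mp hF)]

theorem aux_inter (p : ℝ) (E : Finset (Sym2 V)) (M : Finset (Sym2 V) → Finset V)
    (L : Finset V) :
    expVal p E (fun F => ((L ∩ M F).card : ℝ)) =
      ∑ v ∈ L, probEvent p E (fun F => v ∈ M F) := by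
  unfold expVal probEvent
  rw [Finset.sum_comm]
  apply Finset.sum_congr rfl
  intro F _
  beta_reduce
  have h : ∑ x ∈ L, (if x ∈ M F then edgeWeight p E F else 0) =
      ((L ∩ M F).card : ℝ) * edgeWeight p E F := by
    rw [Finset.sum_ite_mem, Finset.sum_const, nsmul_eq_mul]
  rw [mul_comm, ← h]
  apply Finset.sum_congr rfl
  intro x _
  by_cases hx : x ∈ M F
  · rw [if_pos hx, if_pos hx]
  · rw [if_neg hx, if_neg hx]

/-- Claim 4.2. For any `ε ≤ 1/4`, the set
`L = {v ∈ V : Pr[v ∈ MVC(G*)] ≥ 1 − 2ε}` satisfies `E[|L \ MVC(G*)|] ≤ 4ε·opt`. -/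
theorem large_prob_vertices_excess
    (G : SimpleGraph V) [DecidableRel G.Adj]
    (p : ℝ) (hp0 : 0 < p) (hp1 : p ≤ 1)
    (MVC : Finset (Sym2 V) → Finset V)
    (hMVC : IsMinCoverFn G.edgeFinset MVC)
    (opt : ℝ) (hopt : opt = optVal p G.edgeFinset MVC)
    (ε : ℝ) (hε0 : 0 < ε) (hε1 : ε ≤ 1 / 4)
    (L : Finset V)
    (hL : L = Finset.univ.filter fun v =>
      1 - 2 * ε ≤ probEvent p G.edgeFinset fun F => v ∈ MVC F) :
    expVal p G.edgeFinset (fun F => ((L \ MVC F).card : ℝ)) ≤ 4 * ε * opt := by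
  have hw : ∀ F, 0 ≤ edgeWeight p G.edgeFinset F := fun F =>
    mul_nonneg (pow_nonneg hp0.le _) (pow_nonneg (by linarith) _)
  have h1 : expVal p G.edgeFinset (fun F => ((L \ MVC F).card : ℝ)) +
      expVal p G.edgeFinset (fun F => ((L ∩ MVC F).card : ℝ)) = L.card := by
    unfold expVal
    rw [← Finset.sum_add_distrib]
    calc _ = ∑ F ∈ G.edgeFinset.powerset, edgeWeight p G.edgeFinset F * (L.card : ℝ) := by
          apply Finset.sum_congr rfl
          intro F _
          rw [← mul_add, ← Nat.cast_add, Finset.card_sdiff_add_card_inter]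
      _ = _ := by rw [← Finset.sum_mul, aux_total, one_mul]
  have h2 : expVal p G.edgeFinset (fun F => ((L ∩ MVC F).card : ℝ)) ≤ opt := by
    rw [hopt]
    unfold optVal expVal
    apply Finset.sum_le_sum
    intro F _
    apply mul_le_mul_of_nonneg_left _ (hw F)
    beta_reduce
    exact_mod_cast Finset.card_le_card Finset.inter_subset_right
  have h3 : (L.card : ℝ) * (1 - 2 * ε) ≤
      expVal p G.edgeFinset (fun F => ((L ∩ MVC F).card : ℝ)) := by
    rw [aux_inter, ← nsmul_eq_mul]
    apply Finset.card_nsmul_le_sum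
    intro v hv
    rw [hL] at hv
    exact (Finset.mem_filter.mp hv).2
  have h4 : (0 : ℝ) ≤ L.card := Nat.cast_nonneg _
  have h5 : (L.card : ℝ) ≤ 2 * opt := by nlinarith
  nlinarith
end
end

section
/- Let X be the number of edges of G that are not covered by MVC(G*), i.e., X = |{e = (u,v) ∈ E : u ∉ MVC(G*) and v ∉ MVC(G*)}|. Then for every n ≥ 1, E[X] ≤ n/p + 6. -/
open Finset

noncomputable section
open scoped Classical

variable {V : Type*} [Fintype V] [DecidableEq V]

theorem aux_sum_weight (p : ℝ) (E M : Finset (Sym2 V)) (hM : M ⊆ E) :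
    ∑ F ∈ (E \ M).powerset, edgeWeight p E F = (1 - p) ^ M.card := by
  have h := Finset.sum_pow_mul_eq_add_pow p (1 - p) (E \ M)
  have h1 : p + (1 - p) = 1 := by ring
  rw [h1, one_pow] at h
  calc ∑ F ∈ (E \ M).powerset, edgeWeight p E F
      = ∑ F ∈ (E \ M).powerset,
          (p ^ F.card * (1 - p) ^ ((E \ M).card - F.card)) * (1 - p) ^ M.card := by
        refine Finset.sum_congr rfl fun F hF => ?_
        have hF' := Finset.mem_powerset.1 hF
        have hFE : F ⊆ E := hF'.trans Finset.sdiff_subset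
        have c1 := Finset.card_le_card hF'
        have c2 := Finset.card_sdiff_of_subset hM
        have c3 := Finset.card_sdiff_of_subset hFE
        have c4 := Finset.card_le_card hM
        have e : (E \ F).card = ((E \ M).card - F.card) + M.card := by omega
        rw [edgeWeight, e, pow_add, mul_assoc]
    _ = (1 - p) ^ M.card := by rw [← Finset.sum_mul, h, one_mul]

theorem aux_nonneg (p : ℝ) (hp0 : 0 < p) (hp1 : p ≤ 1) (E F : Finset (Sym2 V)) :
    0 ≤ edgeWeight p E F :=
  mul_nonneg (pow_nonneg hp0.le _) (pow_nonneg (by linarith) _)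

theorem aux_exp (p : ℝ) (hp0 : 0 < p) (hp1 : p ≤ 1) (E : Finset (Sym2 V))
    (MVC : Finset (Sym2 V) → Finset V) (hMVC : IsMinCoverFn E MVC) :
    ∑ F ∈ E.powerset, edgeWeight p E F *
      Real.exp (p * ((E.filter fun e => ∀ v ∈ e, v ∉ MVC F).card : ℝ)) ≤
      2 ^ Fintype.card V := by
  rw [← Finset.sum_fiberwise_of_maps_to (s := E.powerset) (t := (Finset.univ : Finset (Finset V)))
    (g := MVC) (fun _ _ => Finset.mem_univ _)]
  have key : ∀ S : Finset V, ∑ F ∈ E.powerset with MVC F = S, edgeWeight p E F *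
      Real.exp (p * ((E.filter fun e => ∀ v ∈ e, v ∉ MVC F).card : ℝ)) ≤ 1 := by
    intro S
    set M := E.filter fun e => ∀ v ∈ e, v ∉ S with hMdef
    have hM : M ⊆ E := Finset.filter_subset _ _
    calc _ = ∑ F ∈ E.powerset with MVC F = S, edgeWeight p E F * Real.exp (p * (M.card : ℝ)) := by
          refine Finset.sum_congr rfl fun F hF => ?_
          rw [(Finset.mem_filter.1 hF).2]
      _ = (∑ F ∈ E.powerset with MVC F = S, edgeWeight p E F) * Real.exp (p * (M.card : ℝ)) := by
          rw [Finset.sum_mul]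
      _ ≤ (∑ F ∈ (E \ M).powerset, edgeWeight p E F) * Real.exp (p * (M.card : ℝ)) := by
          refine mul_le_mul_of_nonneg_right ?_ (Real.exp_pos _).le
          refine Finset.sum_le_sum_of_subset_of_nonneg ?_ fun F _ _ => aux_nonneg p hp0 hp1 E F
          intro F hF
          obtain ⟨hF1, hF2⟩ := Finset.mem_filter.1 hF
          have hFE := Finset.mem_powerset.1 hF1
          refine Finset.mem_powerset.2 fun e he => Finset.mem_sdiff.2 ⟨hFE he, fun heM => ?_⟩
          obtain ⟨v, hv, hve⟩ := (hMVC F hFE).1 e he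
          rw [hF2] at hv
          exact (Finset.mem_filter.1 heM).2 v hve hv
      _ = ((1 - p) * Real.exp p) ^ M.card := by
          rw [aux_sum_weight p E M hM, mul_pow, ← Real.exp_nat_mul, mul_comm p]
      _ ≤ 1 := by
          refine pow_le_one₀ (mul_nonneg (by linarith) (Real.exp_pos _).le) ?_
          calc (1 - p) * Real.exp p ≤ Real.exp (-p) * Real.exp p :=
                mul_le_mul_of_nonneg_right (Real.one_sub_le_exp_neg p) (Real.exp_pos _).le
            _ = 1 := by rw [← Real.exp_add]; simp
  refine (Finset.sum_le_sum fun S _ => key S).trans ?_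
  simp

/-- Eq. (4), Lemma 4.6. Let `X` be the number of edges of `G` not
covered by `MVC(G*)`, i.e. `X = |{e = (u,v) ∈ E : u ∉ MVC(G*) and v ∉ MVC(G*)}|`.
Then for every `n ≥ 1`, `E[X] ≤ n/p + 6`. -/
theorem uncovered_edges_expectation
    (G : SimpleGraph V) [DecidableRel G.Adj]
    (p : ℝ) (hp0 : 0 < p) (hp1 : p ≤ 1)
    (MVC : Finset (Sym2 V) → Finset V)
    (hMVC : IsMinCoverFn G.edgeFinset MVC)
    (hn : 1 ≤ Fintype.card V) :
    expVal p G.edgeFinset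
        (fun F => ((G.edgeFinset.filter fun e => ∀ v ∈ e, v ∉ MVC F).card : ℝ)) ≤
      (Fintype.card V : ℝ) / p + 6 := by
  set E := G.edgeFinset with hE
  set n : ℝ := (Fintype.card V : ℝ) with hn'
  have h1 := aux_exp p hp0 hp1 E MVC hMVC
  have h2 : (2 : ℝ) ^ Fintype.card V ≤ Real.exp n := by
    rw [hn', ← mul_one (Fintype.card V : ℝ), Real.exp_nat_mul]
    exact pow_le_pow_left₀ (by norm_num) (by linarith [Real.add_one_le_exp (1 : ℝ)]) _
  have h0 : ∑ F ∈ E.powerset, edgeWeight p E F = 1 := by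
    simpa using aux_sum_weight p E ∅ (Finset.empty_subset _)
  set X : Finset (Sym2 V) → ℝ := fun F => ((E.filter fun e => ∀ v ∈ e, v ∉ MVC F).card : ℝ) with hX
  have h3 : Real.exp n * ((1 - n) + p * expVal p E X) ≤ Real.exp n * 1 := by
    rw [mul_one]
    calc Real.exp n * ((1 - n) + p * expVal p E X)
        = ∑ F ∈ E.powerset, edgeWeight p E F * (Real.exp n * ((1 - n) + p * X F)) := by
          have : (1 - n) = ∑ F ∈ E.powerset, edgeWeight p E F * (1 - n) := by
            rw [← Finset.sum_mul, h0, one_mul]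
          conv_lhs => rw [this]
          rw [expVal, Finset.mul_sum, ← Finset.sum_add_distrib, Finset.mul_sum]
          refine Finset.sum_congr rfl fun F _ => ?_
          ring
      _ ≤ ∑ F ∈ E.powerset, edgeWeight p E F * Real.exp (p * X F) := by
          refine Finset.sum_le_sum fun F _ =>
            mul_le_mul_of_nonneg_left ?_ (aux_nonneg p hp0 hp1 E F)
          have := Real.add_one_le_exp (p * X F - n)
          calc Real.exp n * ((1 - n) + p * X F) ≤ Real.exp n * Real.exp (p * X F - n) :=
                mul_le_mul_of_nonneg_left (by linarith) (Real.exp_pos _).le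
            _ = Real.exp (p * X F) := by rw [← Real.exp_add]; congr 1; ring
      _ ≤ Real.exp n := h1.trans h2
  have h4 := le_of_mul_le_mul_left h3 (Real.exp_pos n)
  have h5 : expVal p E X ≤ n / p := by
    rw [le_div_iff₀ hp0]; linarith
  linarith
end
end

section
/- The probability that the induced subgraph G[V \ MVC(G*)] of the base graph G contains more than n/p edges is at most (2/e)^n. -/
open Finset

noncomputable section
open scoped Classical

variable {V : Type*} [Fintype V] [DecidableEq V]

theorem aux_sum (p : ℝ) (E B : Finset (Sym2 V)) (hB : B ⊆ E) :
    ∑ F ∈ (E \ B).powerset, edgeWeight p E F = (1 - p) ^ B.card := by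
  have h := Finset.sum_pow_mul_eq_add_pow p (1 - p) (E \ B)
  have h2 : ∀ F ∈ (E \ B).powerset, edgeWeight p E F =
      (p ^ F.card * (1 - p) ^ ((E \ B).card - F.card)) * (1 - p) ^ B.card := by
    intro F hF
    have hF := Finset.mem_powerset.1 hF
    have hFE : F ⊆ E := hF.trans Finset.sdiff_subset
    have e1 := Finset.card_sdiff_of_subset hFE
    have e2 := Finset.card_sdiff_of_subset hB
    have e3 := Finset.card_le_card hF
    have e4 := Finset.card_le_card hB
    have e5 : (E \ F).card = ((E \ B).card - F.card) + B.card := by omega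
    unfold edgeWeight
    rw [e5, pow_add, mul_assoc]
  rw [Finset.sum_congr rfl h2, ← Finset.sum_mul, h]
  simp

/-- from Lemma 4.6. The probability that the induced subgraph
`G[V \ MVC(G*)]` of the base graph `G` contains more than `n/p` edges is at most
`(2/e)^n`. -/
theorem uncovered_edges_tail
    (G : SimpleGraph V) [DecidableRel G.Adj]
    (p : ℝ) (hp0 : 0 < p) (hp1 : p ≤ 1)
    (MVC : Finset (Sym2 V) → Finset V)
    (hMVC : IsMinCoverFn G.edgeFinset MVC) :
    probEvent p G.edgeFinset
        (fun F => (Fintype.card V : ℝ) / p < (inducedEdgeCount G (MVC F) : ℝ)) ≤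
      (2 / Real.exp 1) ^ Fintype.card V := by
  set E := G.edgeFinset with hE
  set n := Fintype.card V with hn
  let B : Finset V → Finset (Sym2 V) := fun S => E.filter fun e => ∀ v ∈ e, v ∉ S
  have hq : 0 ≤ 1 - p := by linarith
  have hw : ∀ F, 0 ≤ edgeWeight p E F := fun F =>
    mul_nonneg (pow_nonneg hp0.le _) (pow_nonneg hq _)
  have h1 : probEvent p E (fun F => (n : ℝ) / p < (inducedEdgeCount G (MVC F) : ℝ)) ≤
      ∑ F ∈ E.powerset, ∑ S : Finset V,
        if ((n : ℝ) / p < ((B S).card : ℝ) ∧ F ⊆ E \ B S) then edgeWeight p E F else 0 := by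
    unfold probEvent
    refine Finset.sum_le_sum fun F hF => ?_
    have hF := Finset.mem_powerset.1 hF
    have hnn : ∀ S ∈ (Finset.univ : Finset (Finset V)), 0 ≤
        (if ((n : ℝ) / p < ((B S).card : ℝ) ∧ F ⊆ E \ B S) then edgeWeight p E F else 0) := by
      intro S _
      split_ifs
      · exact hw F
      · exact le_rfl
    split_ifs with hc
    · refine le_trans ?_ (Finset.single_le_sum hnn (Finset.mem_univ (MVC F)))
      rw [if_pos]
      refine ⟨hc, fun e he => ?_⟩
      obtain ⟨v, hv, hve⟩ := (hMVC F hF).1 e he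
      refine Finset.mem_sdiff.2 ⟨hF he, fun hb => ?_⟩
      exact (Finset.mem_filter.1 hb).2 v hve hv
    · exact Finset.sum_nonneg hnn
  have h2 : ∀ S : Finset V, (∑ F ∈ E.powerset,
      if ((n : ℝ) / p < ((B S).card : ℝ) ∧ F ⊆ E \ B S) then edgeWeight p E F else 0)
      ≤ Real.exp (-(n : ℝ)) := by
    intro S
    by_cases hc : (n : ℝ) / p < ((B S).card : ℝ)
    · simp only [hc, true_and]
      rw [← Finset.sum_filter]
      have e : E.powerset.filter (fun F => F ⊆ E \ B S) = (E \ B S).powerset := by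
        ext F
        simp only [Finset.mem_filter, Finset.mem_powerset]
        exact ⟨fun h => h.2, fun h => ⟨h.trans Finset.sdiff_subset, h⟩⟩
      rw [e, aux_sum p E (B S) (Finset.filter_subset _ _)]
      have h3 : 1 - p ≤ Real.exp (-p) := by
        have := Real.add_one_le_exp (-p)
        linarith
      calc (1 - p) ^ (B S).card ≤ (Real.exp (-p)) ^ (B S).card := pow_le_pow_left₀ hq h3 _
        _ = Real.exp ((B S).card * (-p)) := (Real.exp_nat_mul _ _).symm
        _ ≤ _ := by
          apply Real.exp_le_exp.2
          rw [div_lt_iff₀ hp0] at hc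
          linarith
    · simp only [hc, false_and, if_false, Finset.sum_const_zero]
      exact (Real.exp_pos _).le
  refine h1.trans ?_
  rw [Finset.sum_comm]
  refine (Finset.sum_le_sum fun S _ => h2 S).trans (le_of_eq ?_)
  rw [Finset.sum_const, Finset.card_univ, Fintype.card_finset, nsmul_eq_mul, div_pow,
    ← Real.exp_nat_mul, Real.exp_neg]
  push_cast
  rw [mul_one, div_eq_mul_inv]
end
end
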